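/- As holomorphic functions on ℍ×ℂ, 6·E_{4,2} = E_{4,1}φ_{0,1} − E₄φ_{0,2} = (1/24)(E₄φ_{0,1}² − 2E₆φ_{0,1}φ_{−2,1} + E₄²φ_{−2,1}²). -/

import Mathlib

noncomputable section

open Complex

namespace JacobiPaper

/-- `e2 w = e^{2 π i w}`. -/
def e2 (w : ℂ) : ℂ := Complex.exp (2 * (Real.pi : ℂ) * Complex.I * w)

/-- `q = e^{2 π i τ}`. -/
def qC (τ : ℂ) : ℂ := e2 τ

/-- `ζ = e^{2 π i z}`. -/
def zetaC (z : ℂ) : ℂ := e2 z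

/-- The Dedekind eta function `η(τ) = q^{1/24} ∏_{n ≥ 1} (1 - qⁿ)`. -/
def eta (τ : ℂ) : ℂ :=
  Complex.exp ((Real.pi : ℂ) * Complex.I * τ / 12) * ∏' n : ℕ, (1 - qC τ ^ (n + 1))

/-- The odd Jacobi theta function
`ϑ(τ,z) = q^{1/8} (ζ^{1/2} - ζ^{-1/2}) ∏_{n ≥ 1} (1 - qⁿζ)(1 - qⁿζ⁻¹)(1 - qⁿ)`. -/
def theta (τ z : ℂ) : ℂ :=
  Complex.exp ((Real.pi : ℂ) * Complex.I * τ / 4) *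
    (Complex.exp ((Real.pi : ℂ) * Complex.I * z) - Complex.exp (-((Real.pi : ℂ) * Complex.I * z))) *
    ∏' n : ℕ,
      ((1 - qC τ ^ (n + 1) * zetaC z) * (1 - qC τ ^ (n + 1) * (zetaC z)⁻¹) * (1 - qC τ ^ (n + 1)))

/-- `ϑ₀₀(τ,z) = Σ_{n ∈ ℤ} q^{n²/2} ζⁿ`. -/
def theta00 (τ z : ℂ) : ℂ :=
  ∑' n : ℤ, Complex.exp ((Real.pi : ℂ) * Complex.I * (n : ℂ) ^ 2 * τ +
    2 * (Real.pi : ℂ) * Complex.I * (n : ℂ) * z)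

/-- `ϑ₀₁(τ,z) = Σ_{n ∈ ℤ} (-1)ⁿ q^{n²/2} ζⁿ`. -/
def theta01 (τ z : ℂ) : ℂ :=
  ∑' n : ℤ, (-1 : ℂ) ^ n * Complex.exp ((Real.pi : ℂ) * Complex.I * (n : ℂ) ^ 2 * τ +
    2 * (Real.pi : ℂ) * Complex.I * (n : ℂ) * z)

/-- `ϑ₁₀(τ,z) = q^{1/8} ζ^{1/2} Σ_{n ∈ ℤ} q^{n(n+1)/2} ζⁿ`. -/
def theta10 (τ z : ℂ) : ℂ :=
  Complex.exp ((Real.pi : ℂ) * Complex.I * τ / 4) * Complex.exp ((Real.pi : ℂ) * Complex.I * z) *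
    ∑' n : ℤ, Complex.exp ((Real.pi : ℂ) * Complex.I * (n : ℂ) * ((n : ℂ) + 1) * τ +
      2 * (Real.pi : ℂ) * Complex.I * (n : ℂ) * z)

/-- `ξ₀₀(τ,z) = ϑ₀₀(τ,z)/ϑ₀₀(τ,0)`. -/
def xi00 (τ z : ℂ) : ℂ := theta00 τ z / theta00 τ 0

/-- `ξ₀₁(τ,z) = ϑ₀₁(τ,z)/ϑ₀₁(τ,0)`. -/
def xi01 (τ z : ℂ) : ℂ := theta01 τ z / theta01 τ 0

/-- `ξ₁₀(τ,z) = ϑ₁₀(τ,z)/ϑ₁₀(τ,0)`. -/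
def xi10 (τ z : ℂ) : ℂ := theta10 τ z / theta10 τ 0

/-- The weak Jacobi form `φ_{0,1} = 4(ξ₀₀² + ξ₀₁² + ξ₁₀²)`. -/
def phi01 (τ z : ℂ) : ℂ := 4 * (xi00 τ z ^ 2 + xi01 τ z ^ 2 + xi10 τ z ^ 2)

/-- The weak Jacobi form `φ_{0,2}(τ,z) = 2(ξ₀₀ + ξ₀₁ + ξ₁₀)(τ,2z)`. -/
def phi02 (τ z : ℂ) : ℂ := 2 * (xi00 τ (2 * z) + xi01 τ (2 * z) + xi10 τ (2 * z))

/-- The weak Jacobi form `φ_{0,3}(τ,z) = ϑ(τ,2z)²/ϑ(τ,z)²`. -/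
def phi03 (τ z : ℂ) : ℂ := theta τ (2 * z) ^ 2 / theta τ z ^ 2

/-- The weak Jacobi form `φ_{0,4}(τ,z) = ϑ(τ,3z)/ϑ(τ,z)`. -/
def phi04 (τ z : ℂ) : ℂ := theta τ (3 * z) / theta τ z

/-- The weak Jacobi form `φ_{-2,1}(τ,z) = ϑ(τ,z)²/η(τ)⁶`. -/
def phiM21 (τ z : ℂ) : ℂ := theta τ z ^ 2 / eta τ ^ 6

/-- The divisor power sum `σ_k(n)`. -/
def sigma' (k n : ℕ) : ℕ := ∑ d ∈ n.divisors, d ^ k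

/-- The normalized Eisenstein series `E_k(τ) = 1 - (2k/B_k) Σ_{n ≥ 1} σ_{k-1}(n) qⁿ`. -/
def Eis (k : ℕ) (τ : ℂ) : ℂ :=
  1 - (2 * (k : ℂ) / ((bernoulli k : ℚ) : ℂ)) *
    ∑' n : ℕ, (sigma' (k - 1) (n + 1) : ℂ) * qC τ ^ (n + 1)

/-- The discriminant cusp form `Δ = η²⁴`. -/
def Delta (τ : ℂ) : ℂ := eta τ ^ 24

/-- The modular invariant `j = E₄³/Δ`. -/
def jInv (τ : ℂ) : ℂ := Eis 4 τ ^ 3 / Delta τ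

/-- A choice of `(a, b)` with `a d - b c = 1` completing a coprime pair `(c, d)` to a matrix
`(a b; c d) ∈ SL₂(ℤ)`. -/
def bezout (c d : ℤ) : ℤ × ℤ :=
  haveI : Decidable (∃ ab : ℤ × ℤ, ab.1 * d - ab.2 * c = 1) := Classical.propDecidable _
  if h : ∃ ab : ℤ × ℤ, ab.1 * d - ab.2 * c = 1 then h.choose else 0

/-- The summand `(cτ+d)^{-k} Σ_{l ∈ ℤ} e^{2πim(l²(aτ+b)/(cτ+d) + 2lz/(cτ+d) - cz²/(cτ+d))}`
of the Jacobi–Eisenstein series attached to a coprime pair `(c,d)`; it does not depend on the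
choice of `(a,b)` completing `(c,d)` to an element of `SL₂(ℤ)`. -/
def EisJSummand (k m : ℕ) (τ z : ℂ) (c d : ℤ) : ℂ :=
  ((c : ℂ) * τ + (d : ℂ)) ^ (-(k : ℤ)) *
    ∑' l : ℤ, e2 ((m : ℂ) * ((l : ℂ) ^ 2 * (((bezout c d).1 : ℂ) * τ + ((bezout c d).2 : ℂ)) /
        ((c : ℂ) * τ + (d : ℂ)) +
      2 * (l : ℂ) * z / ((c : ℂ) * τ + (d : ℂ)) - (c : ℂ) * z ^ 2 / ((c : ℂ) * τ + (d : ℂ))))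

/-- The Jacobi–Eisenstein series `E_{k,m}` of weight `k` and index `m`. -/
def EisJ (k m : ℕ) (τ z : ℂ) : ℂ :=
  (1 / 2) * ∑' p : {p : ℤ × ℤ // IsCoprime p.1 p.2}, EisJSummand k m τ z p.1.1 p.1.2

/-- `F_{6,3} = (1/2)(E_{6,1} φ_{0,2} - E₆ φ_{0,3})`. -/
def F63 (τ z : ℂ) : ℂ := (1 / 2) * (EisJ 6 1 τ z * phi02 τ z - Eis 6 τ * phi03 τ z)

/-- A weak Jacobi form of weight `k ∈ ℤ` and index `m ∈ ℕ`: a holomorphic function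
`φ : ℍ × ℂ → ℂ` satisfying the two Jacobi transformation laws and having a Fourier expansion
`φ(τ,z) = Σ_{n ≥ 0, l ∈ ℤ} f(n,l) qⁿ ζˡ`. -/
def IsWeakJacobiForm (k : ℤ) (m : ℕ) (φ : ℂ → ℂ → ℂ) (f : ℕ → ℤ → ℂ) : Prop :=
  DifferentiableOn ℂ (fun p : ℂ × ℂ => φ p.1 p.2) {p : ℂ × ℂ | 0 < p.1.im} ∧
  (∀ a b c d : ℤ, a * d - b * c = 1 → ∀ τ z : ℂ, 0 < τ.im →
    φ (((a : ℂ) * τ + (b : ℂ)) / ((c : ℂ) * τ + (d : ℂ))) (z / ((c : ℂ) * τ + (d : ℂ))) =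
      ((c : ℂ) * τ + (d : ℂ)) ^ k *
        e2 ((m : ℂ) * ((c : ℂ) * z ^ 2 / ((c : ℂ) * τ + (d : ℂ)))) * φ τ z) ∧
  (∀ x y : ℤ, ∀ τ z : ℂ, 0 < τ.im →
    φ τ (z + (x : ℂ) * τ + (y : ℂ)) =
      e2 (-(m : ℂ) * ((x : ℂ) ^ 2 * τ + 2 * (x : ℂ) * z)) * φ τ z) ∧
  (∀ τ z : ℂ, 0 < τ.im →
    HasSum (fun p : ℕ × ℤ => f p.1 p.2 * e2 ((p.1 : ℂ) * τ + (p.2 : ℂ) * z)) (φ τ z))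

/-- A weakly holomorphic Jacobi form of weight `0` and index `m ∈ ℕ`: as a weak Jacobi form,
but the Fourier expansion `φ(τ,z) = Σ_{n ≥ n₀, l ∈ ℤ} f(n,l) qⁿ ζˡ` may contain finitely many
negative powers of `q`. -/
def IsWeaklyHolomorphicJacobiForm0 (m : ℕ) (φ : ℂ → ℂ → ℂ) (f : ℤ → ℤ → ℂ) : Prop :=
  DifferentiableOn ℂ (fun p : ℂ × ℂ => φ p.1 p.2) {p : ℂ × ℂ | 0 < p.1.im} ∧
  (∀ a b c d : ℤ, a * d - b * c = 1 → ∀ τ z : ℂ, 0 < τ.im →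
    φ (((a : ℂ) * τ + (b : ℂ)) / ((c : ℂ) * τ + (d : ℂ))) (z / ((c : ℂ) * τ + (d : ℂ))) =
      e2 ((m : ℂ) * ((c : ℂ) * z ^ 2 / ((c : ℂ) * τ + (d : ℂ)))) * φ τ z) ∧
  (∀ x y : ℤ, ∀ τ z : ℂ, 0 < τ.im →
    φ τ (z + (x : ℂ) * τ + (y : ℂ)) =
      e2 (-(m : ℂ) * ((x : ℂ) ^ 2 * τ + 2 * (x : ℂ) * z)) * φ τ z) ∧
  (∃ n₀ : ℤ, ∀ n : ℤ, n < n₀ → ∀ l : ℤ, f n l = 0) ∧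
  (∀ τ z : ℂ, 0 < τ.im →
    HasSum (fun p : ℤ × ℤ => f p.1 p.2 * e2 ((p.1 : ℂ) * τ + (p.2 : ℂ) * z)) (φ τ z))

/-- A function `φ` on `ℍ × ℂ` has integral Fourier coefficients if it is the sum of a Fourier
series `Σ_{n ≥ 0, l ∈ ℤ} f(n,l) qⁿ ζˡ` with all `f(n,l) ∈ ℤ`. -/
def HasIntegralFourierExpansion (φ : ℂ → ℂ → ℂ) : Prop :=
  ∃ f : ℕ → ℤ → ℤ, ∀ τ z : ℂ, 0 < τ.im →
    HasSum (fun p : ℕ × ℤ => (f p.1 p.2 : ℂ) * e2 ((p.1 : ℂ) * τ + (p.2 : ℂ) * z)) (φ τ z)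

lemma hasSum_of_eq {β : Type*} {f g : β → ℂ} {a : ℂ} (hf : HasSum f a) (h : ∀ x, f x = g x) :
    HasSum g a := by
  rwa [← funext h]

lemma theta00_eq (τ z : ℂ) : theta00 τ z = jacobiTheta₂ z τ := by
  unfold theta00 jacobiTheta₂ jacobiTheta₂_term
  refine tsum_congr fun n => ?_
  congr 1; ring

lemma theta01_eq (τ z : ℂ) : theta01 τ z = theta00 τ (z + 1 / 2) := by
  unfold theta01 theta00
  refine tsum_congr fun n => ?_
  rw [← Complex.exp_pi_mul_I, ← Complex.exp_int_mul, ← Complex.exp_add]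
  congr 1; ring

lemma theta10_eq (τ z : ℂ) : theta10 τ z =
    cexp ((Real.pi : ℂ) * I * τ / 4 + (Real.pi : ℂ) * I * z) * theta00 τ (z + τ / 2) := by
  unfold theta10 theta00
  rw [← Complex.exp_add]
  congr 1
  refine tsum_congr fun n => ?_
  congr 1; ring

lemma theta00_add_one (τ z : ℂ) : theta00 τ (z + 1) = theta00 τ z := by
  simp only [theta00_eq, jacobiTheta₂_add_left]

lemma theta00_add_tau (τ z : ℂ) : theta00 τ (z + τ) =
    cexp (-(Real.pi : ℂ) * I * (τ + 2 * z)) * theta00 τ z := by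
  simp only [theta00_eq, jacobiTheta₂_add_left']

lemma theta10_add_one (τ z : ℂ) : theta10 τ (z + 1) = -theta10 τ z := by
  rw [theta10_eq, theta10_eq, show z + 1 + τ / 2 = (z + τ / 2) + 1 by ring, theta00_add_one,
    show (Real.pi : ℂ) * I * τ / 4 + (Real.pi : ℂ) * I * (z + 1) =
      ((Real.pi : ℂ) * I * τ / 4 + (Real.pi : ℂ) * I * z) + (Real.pi : ℂ) * I by ring,
    Complex.exp_add _ ((Real.pi : ℂ) * I), Complex.exp_pi_mul_I]
  ring

lemma hasSum_theta00 {τ : ℂ} (hτ : 0 < τ.im) (z : ℂ) :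
    HasSum (fun n : ℤ => cexp ((Real.pi : ℂ) * I * (n : ℂ) ^ 2 * τ +
      2 * (Real.pi : ℂ) * I * (n : ℂ) * z)) (theta00 τ z) := by
  rw [theta00_eq]
  convert hasSum_jacobiTheta₂_term z hτ using 2 with n
  unfold jacobiTheta₂_term
  congr 1; ring

lemma hasSum_theta10 {τ : ℂ} (hτ : 0 < τ.im) (z : ℂ) :
    HasSum (fun n : ℤ => cexp ((Real.pi : ℂ) * I * ((n : ℂ) + 1 / 2) ^ 2 * τ +
      2 * (Real.pi : ℂ) * I * ((n : ℂ) + 1 / 2) * z)) (theta10 τ z) := by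
  rw [theta10_eq]
  refine hasSum_of_eq ((hasSum_theta00 hτ (z + τ / 2)).mul_left _) fun n => ?_
  rw [← Complex.exp_add]
  congr 1; ring

lemma hasSum_mul_of_norm {f g : ℤ → ℂ} {a b : ℂ} (hf : HasSum f a) (hg : HasSum g b) :
    HasSum (fun p : ℤ × ℤ => f p.1 * g p.2) (a * b) := by
  have h := summable_mul_of_summable_norm hf.summable.norm hg.summable.norm
  have := h.hasSum
  rwa [← tsum_mul_tsum_of_summable_norm hf.summable.norm hg.summable.norm, hf.tsum_eq,
    hg.tsum_eq] at this

lemma hasSum_parity_split {f g h : ℤ × ℤ → ℂ} {a b c : ℂ} (hf : HasSum f a) (hg : HasSum g b)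
    (hh : HasSum h c) (h1 : ∀ m n, g (m, n) = f (m + n, m - n))
    (h2 : ∀ m n, h (m, n) = f (m + n + 1, m - n)) : a = b + c := by
  have inj1 : Function.Injective (fun p : ℤ × ℤ => (p.1 + p.2, p.1 - p.2)) := by
    rintro ⟨a, b⟩ ⟨c, d⟩ h
    simp only [Prod.mk.injEq] at h ⊢
    omega
  have inj2 : Function.Injective (fun p : ℤ × ℤ => (p.1 + p.2 + 1, p.1 - p.2)) := by
    rintro ⟨a, b⟩ ⟨c, d⟩ h
    simp only [Prod.mk.injEq] at h ⊢
    omega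
  have hc : IsCompl (Set.range (fun p : ℤ × ℤ => (p.1 + p.2, p.1 - p.2)))
      (Set.range (fun p : ℤ × ℤ => (p.1 + p.2 + 1, p.1 - p.2))) := by
    rw [isCompl_iff, Set.disjoint_left, codisjoint_iff_le_sup]
    constructor
    · rintro _ ⟨⟨a, b⟩, rfl⟩ ⟨⟨c, d⟩, h⟩
      simp only [Prod.mk.injEq] at h
      omega
    · rintro ⟨m, n⟩ -
      rcases Int.even_or_odd' (m + n) with ⟨a, ha | ha⟩
      · exact Or.inl ⟨(a, m - a), by simp only [Prod.mk.injEq]; omega⟩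
      · exact Or.inr ⟨(a, m - 1 - a), by simp only [Prod.mk.injEq]; omega⟩
  refine hf.unique (HasSum.add_isCompl hc ((Function.Injective.hasSum_range_iff inj1).2 ?_)
    ((Function.Injective.hasSum_range_iff inj2).2 ?_))
  · exact hasSum_of_eq hg fun p => h1 p.1 p.2
  · exact hasSum_of_eq hh fun p => h2 p.1 p.2

lemma theta00_mul {τ : ℂ} (hτ : 0 < τ.im) (x y : ℂ) : theta00 τ x * theta00 τ y =
    theta00 (2 * τ) (x + y) * theta00 (2 * τ) (x - y) +
      theta10 (2 * τ) (x + y) * theta10 (2 * τ) (x - y) := by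
  have hτ2 : 0 < (2 * τ).im := by simpa using hτ
  have h1 := hasSum_mul_of_norm (hasSum_theta00 hτ x) (hasSum_theta00 hτ y)
  have h2 := hasSum_mul_of_norm (hasSum_theta00 hτ2 (x + y)) (hasSum_theta00 hτ2 (x - y))
  have h3 := hasSum_mul_of_norm (hasSum_theta10 hτ2 (x + y)) (hasSum_theta10 hτ2 (x - y))
  refine hasSum_parity_split h1 h2 h3 (fun m n => ?_) (fun m n => ?_)
  · rw [← Complex.exp_add, ← Complex.exp_add]
    congr 1; push_cast; ring
  · rw [← Complex.exp_add, ← Complex.exp_add]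
    congr 1; push_cast; ring

lemma theta10_shift (τ u : ℂ) : cexp ((Real.pi : ℂ) * I * τ / 2 + (Real.pi : ℂ) * I * u) *
    theta00 (2 * τ) (u + τ) = theta10 (2 * τ) u := by
  rw [theta10_eq, show u + 2 * τ / 2 = u + τ by ring]
  congr 2; ring

lemma theta00_shift (τ u : ℂ) : cexp ((Real.pi : ℂ) * I * τ / 2 + (Real.pi : ℂ) * I * u) *
    theta10 (2 * τ) (u + τ) = theta00 (2 * τ) u := by
  rw [theta10_eq, show u + τ + 2 * τ / 2 = u + 2 * τ by ring, theta00_add_tau, ← mul_assoc,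
    ← mul_assoc, ← Complex.exp_add, ← Complex.exp_add]
  conv_rhs => rw [← one_mul (theta00 (2 * τ) u), ← Complex.exp_zero]
  congr 2; ring

lemma theta00_sq {τ : ℂ} (hτ : 0 < τ.im) (z : ℂ) : theta00 τ z ^ 2 =
    theta00 (2 * τ) 0 * theta00 (2 * τ) (2 * z) + theta10 (2 * τ) 0 * theta10 (2 * τ) (2 * z) := by
  rw [sq, theta00_mul hτ, sub_self, ← two_mul]; ring

lemma theta01_sq {τ : ℂ} (hτ : 0 < τ.im) (z : ℂ) : theta01 τ z ^ 2 =
    theta00 (2 * τ) 0 * theta00 (2 * τ) (2 * z) - theta10 (2 * τ) 0 * theta10 (2 * τ) (2 * z) := by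
  rw [theta01_eq, theta00_sq hτ, show 2 * (z + 1 / 2) = 2 * z + 1 by ring, theta00_add_one,
    theta10_add_one]; ring

lemma theta10_mul {τ : ℂ} (hτ : 0 < τ.im) (x y : ℂ) : theta10 τ x * theta10 τ y =
    theta10 (2 * τ) (x + y) * theta00 (2 * τ) (x - y) +
      theta00 (2 * τ) (x + y) * theta10 (2 * τ) (x - y) := by
  rw [theta10_eq, theta10_eq, mul_mul_mul_comm, ← Complex.exp_add, theta00_mul hτ,
    show x + τ / 2 + (y + τ / 2) = (x + y) + τ by ring,
    show x + τ / 2 - (y + τ / 2) = x - y by ring, ← theta10_shift τ (x + y),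
    ← theta00_shift τ (x + y),
    show (Real.pi : ℂ) * I * τ / 4 + Real.pi * I * x + (Real.pi * I * τ / 4 + Real.pi * I * y) =
      Real.pi * I * τ / 2 + Real.pi * I * (x + y) by ring]
  ring

lemma theta10_sq {τ : ℂ} (hτ : 0 < τ.im) (z : ℂ) : theta10 τ z ^ 2 =
    theta10 (2 * τ) 0 * theta00 (2 * τ) (2 * z) + theta00 (2 * τ) 0 * theta10 (2 * τ) (2 * z) := by
  rw [sq, theta10_mul hτ, sub_self, ← two_mul]; ring

lemma theta10_half_sq {τ : ℂ} (hτ : 0 < τ.im) (z : ℂ) : theta10 τ (z + 1 / 2) ^ 2 =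
    theta10 (2 * τ) 0 * theta00 (2 * τ) (2 * z) - theta00 (2 * τ) 0 * theta10 (2 * τ) (2 * z) := by
  rw [theta10_sq hτ, show 2 * (z + 1 / 2) = 2 * z + 1 by ring, theta00_add_one,
    theta10_add_one]; ring

lemma theta00_double {τ : ℂ} (hτ : 0 < τ.im) (z : ℂ) : theta00 τ (2 * z) * theta00 τ 0 =
    theta00 (2 * τ) (2 * z) ^ 2 + theta10 (2 * τ) (2 * z) ^ 2 := by
  rw [theta00_mul hτ]; simp; ring

lemma theta01_double {τ : ℂ} (hτ : 0 < τ.im) (z : ℂ) : theta01 τ (2 * z) * theta01 τ 0 =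
    theta00 (2 * τ) (2 * z) ^ 2 - theta10 (2 * τ) (2 * z) ^ 2 := by
  rw [theta01_eq, theta01_eq, theta00_mul hτ,
    show 2 * z + 1 / 2 + (0 + 1 / 2) = 2 * z + 1 by ring,
    show 2 * z + 1 / 2 - (0 + 1 / 2) = 2 * z by ring, theta00_add_one, theta10_add_one]; ring

lemma theta10_double {τ : ℂ} (hτ : 0 < τ.im) (z : ℂ) : theta10 τ (2 * z) * theta10 τ 0 =
    2 * theta00 (2 * τ) (2 * z) * theta10 (2 * τ) (2 * z) := by
  rw [theta10_mul hτ]; simp; ring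

lemma jacobi_quartic {τ : ℂ} (hτ : 0 < τ.im) :
    theta00 τ 0 ^ 4 = theta01 τ 0 ^ 4 + theta10 τ 0 ^ 4 := by
  rw [show (4 : ℕ) = 2 * 2 by rfl, pow_mul, pow_mul, pow_mul, theta00_sq hτ, theta01_sq hτ,
    theta10_sq hτ]
  simp; ring

/-- The infinite product `∏_{n ≥ 0} (1 + a qⁿ)`. -/
def qProd (a q : ℂ) : ℂ := ∏' n : ℕ, (1 + a * q ^ n)

lemma summable_qProd (a : ℂ) {q : ℂ} (hq : ‖q‖ < 1) : Summable fun n : ℕ => ‖a * q ^ n‖ := by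
  simp only [norm_mul, norm_pow]
  exact (summable_geometric_of_lt_one (norm_nonneg _) hq).mul_left _

lemma multipliable_qProd (a : ℂ) {q : ℂ} (hq : ‖q‖ < 1) :
    Multipliable fun n : ℕ => (1 + a * q ^ n) :=
  multipliable_one_add_of_summable (summable_qProd a hq)

lemma hasProd_qProd (a : ℂ) {q : ℂ} (hq : ‖q‖ < 1) :
    HasProd (fun n : ℕ => (1 + a * q ^ n)) (qProd a q) := (multipliable_qProd a hq).hasProd

lemma qProd_succ (a : ℂ) {q : ℂ} (hq : ‖q‖ < 1) : qProd a q = (1 + a) * qProd (a * q) q := by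
  have h : (fun n : ℕ => 1 + a * q ^ (n + 1)) = fun n : ℕ => 1 + a * q * q ^ n := by
    funext n; ring
  rw [qProd, tprod_eq_zero_mul' (by rw [h]; exact multipliable_qProd _ hq), h, qProd]
  simp

lemma norm_sq_lt_one {q : ℂ} (hq : ‖q‖ < 1) : ‖q ^ 2‖ < 1 := by
  rw [norm_pow]; exact pow_lt_one₀ (norm_nonneg _) hq two_ne_zero

lemma qProd_mul_neg (a : ℂ) {q : ℂ} (hq : ‖q‖ < 1) :
    qProd a q * qProd (-a) q = qProd (-a ^ 2) (q ^ 2) := by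
  refine ((hasProd_qProd a hq).mul (hasProd_qProd (-a) hq)).unique ?_
  convert hasProd_qProd (-a ^ 2) (norm_sq_lt_one hq) using 2 with n
  rw [← pow_mul]; ring

lemma qProd_even_odd (a : ℂ) {q : ℂ} (hq : ‖q‖ < 1) :
    qProd a q = qProd a (q ^ 2) * qProd (a * q) (q ^ 2) := by
  refine (hasProd_qProd a hq).unique (HasProd.even_mul_odd ?_ ?_)
  · convert hasProd_qProd a (norm_sq_lt_one hq) using 2 with n
    rw [← pow_mul]
  · convert hasProd_qProd (a * q) (norm_sq_lt_one hq) using 2 with n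
    rw [← pow_mul]; ring

lemma one_sub_pow_ne_zero {q : ℂ} (hq : ‖q‖ < 1) (n : ℕ) : 1 - q ^ (n + 1) ≠ 0 := by
  intro h
  have h1 : ‖q ^ (n + 1)‖ < 1 := by
    rw [norm_pow]; exact pow_lt_one₀ (norm_nonneg _) hq n.succ_ne_zero
  rw [← sub_eq_zero.1 h, norm_one] at h1
  exact lt_irrefl _ h1

lemma qProd_neg_self_ne_zero {q : ℂ} (hq : ‖q‖ < 1) : qProd (-q) q ≠ 0 := by
  refine tprod_one_add_ne_zero_of_summable (fun n => ?_) (summable_qProd _ hq)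
  convert one_sub_pow_ne_zero hq n using 1
  ring

lemma euler_odd_distinct {q : ℂ} (hq : ‖q‖ < 1) : qProd (-q) (q ^ 2) * qProd q q = 1 := by
  have h1 := qProd_even_odd (-q) hq
  have h2 := qProd_mul_neg q hq
  have h3 := qProd_neg_self_ne_zero hq
  rw [show -q * q = -q ^ 2 by ring, ← h2] at h1
  apply mul_left_cancel₀ h3
  rw [mul_one]
  nth_rewrite 2 [h1]
  ring

/-- The finite product `∏_{i=1}^{n} (1 - qⁱ)`. -/
def qFact (q : ℂ) (n : ℕ) : ℂ := ∏ i ∈ Finset.range n, (1 - q ^ (i + 1))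

lemma tendsto_qFact {q : ℂ} (hq : ‖q‖ < 1) :
    Filter.Tendsto (qFact q) Filter.atTop (nhds (qProd (-q) q)) := by
  convert (hasProd_qProd (-q) hq).tendsto_prod_nat using 2 with n
  refine Finset.prod_congr rfl fun i _ => ?_
  ring

/-- The reciprocal of `qFact`, extended by zero to negative integers. -/
def qFactInv (q : ℂ) (k : ℤ) : ℂ := if 0 ≤ k then (qFact q k.toNat)⁻¹ else 0

lemma qFactInv_sub_one {q : ℂ} (hq : ‖q‖ < 1) (k : ℤ) :
    qFactInv q (k - 1) = (1 - q ^ k) * qFactInv q k := by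
  unfold qFactInv
  rcases lt_trichotomy k 0 with h | h | h
  · rw [if_neg (by omega), if_neg (by omega), mul_zero]
  · subst h; simp
  · obtain ⟨n, rfl⟩ : ∃ n : ℕ, k = n + 1 := ⟨(k - 1).toNat, by omega⟩
    rw [if_pos (by omega), if_pos (by omega), show ((n : ℤ) + 1 - 1).toNat = n by omega,
      show ((n : ℤ) + 1).toNat = n + 1 by omega, qFact, qFact, Finset.prod_range_succ, mul_inv,
      mul_comm, mul_assoc, show ((n : ℤ) + 1) = ((n + 1 : ℕ) : ℤ) by simp, zpow_natCast,
      inv_mul_cancel₀ (one_sub_pow_ne_zero hq n), mul_one]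

lemma tendsto_qFactInv {q : ℂ} (hq : ‖q‖ < 1) :
    Filter.Tendsto (qFactInv q) Filter.atTop (nhds (qProd (-q) q)⁻¹) := by
  have h : Filter.Tendsto (fun k : ℤ => (qFact q k.toNat)⁻¹) Filter.atTop
      (nhds (qProd (-q) q)⁻¹) :=
    ((tendsto_qFact hq).comp (Filter.tendsto_atTop.2 fun n => by
      filter_upwards [Filter.eventually_ge_atTop (n : ℤ)] with k hk
      omega)).inv₀ (qProd_neg_self_ne_zero hq)
  refine h.congr' ?_
  filter_upwards [Filter.eventually_ge_atTop (0 : ℤ)] with k hk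
  rw [qFactInv, if_pos hk]

lemma qFact_bound {q : ℂ} (hq : ‖q‖ < 1) : ∃ C : ℝ, ∀ n, ‖qFact q n‖ ≤ C := by
  obtain ⟨C, hC⟩ := (Metric.isBounded_range_of_tendsto _ (tendsto_qFact hq)).exists_norm_le
  exact ⟨C, fun n => hC _ ⟨n, rfl⟩⟩

lemma qFactInv_bound {q : ℂ} (hq : ‖q‖ < 1) : ∃ C : ℝ, 0 ≤ C ∧ ∀ k, ‖qFactInv q k‖ ≤ C := by
  obtain ⟨C, hC⟩ := (Metric.isBounded_range_of_tendsto _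
    ((tendsto_qFact hq).inv₀ (qProd_neg_self_ne_zero hq))).exists_norm_le
  refine ⟨max C 0, le_max_right _ _, fun k => ?_⟩
  unfold qFactInv
  split_ifs
  · exact (hC _ ⟨k.toNat, rfl⟩).trans (le_max_left _ _)
  · simp

/-- The coefficients of the finite Jacobi triple product. -/
def tripleCoeff (s : ℂ) (N : ℕ) (j : ℤ) : ℂ :=
  s ^ (j ^ 2) * qFact (s ^ 2) (2 * N) * qFactInv (s ^ 2) (N + j) * qFactInv (s ^ 2) (N - j)

lemma tripleCoeff_succ {s : ℂ} (hs0 : s ≠ 0) (hs : ‖s‖ < 1) (N : ℕ) (j : ℤ) :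
    tripleCoeff s (N + 1) j = (1 + s ^ (4 * N + 2)) * tripleCoeff s N j +
      s ^ (2 * N + 1) * (tripleCoeff s N (j - 1) + tripleCoeff s N (j + 1)) := by
  have hq := norm_sq_lt_one hs
  unfold tripleCoeff
  have e1 : qFactInv (s ^ 2) ((N : ℤ) + j) =
      (1 - (s ^ 2) ^ ((N : ℤ) + 1 + j)) * qFactInv (s ^ 2) ((N : ℤ) + 1 + j) := by
    rw [← qFactInv_sub_one hq]; congr 1; ring
  have e2 : qFactInv (s ^ 2) ((N : ℤ) - j) =
      (1 - (s ^ 2) ^ ((N : ℤ) + 1 - j)) * qFactInv (s ^ 2) ((N : ℤ) + 1 - j) := by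
    rw [← qFactInv_sub_one hq]; congr 1; ring
  have e3 : qFactInv (s ^ 2) ((N : ℤ) + (j - 1)) = (1 - (s ^ 2) ^ ((N : ℤ) + j)) *
      ((1 - (s ^ 2) ^ ((N : ℤ) + 1 + j)) * qFactInv (s ^ 2) ((N : ℤ) + 1 + j)) := by
    rw [← e1, ← qFactInv_sub_one hq]; congr 1; ring
  have e4 : qFactInv (s ^ 2) ((N : ℤ) - (j + 1)) = (1 - (s ^ 2) ^ ((N : ℤ) - j)) *
      ((1 - (s ^ 2) ^ ((N : ℤ) + 1 - j)) * qFactInv (s ^ 2) ((N : ℤ) + 1 - j)) := by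
    rw [← e2, ← qFactInv_sub_one hq]; congr 1; ring
  have e5 : qFactInv (s ^ 2) ((N : ℤ) - (j - 1)) = qFactInv (s ^ 2) ((N : ℤ) + 1 - j) := by
    congr 1; ring
  have e6 : qFactInv (s ^ 2) ((N : ℤ) + (j + 1)) = qFactInv (s ^ 2) ((N : ℤ) + 1 + j) := by
    congr 1; ring
  have e7 : qFact (s ^ 2) (2 * (N + 1)) =
      qFact (s ^ 2) (2 * N) * (1 - (s ^ 2) ^ (2 * N + 1)) * (1 - (s ^ 2) ^ (2 * N + 2)) := by
    rw [show 2 * (N + 1) = 2 * N + 1 + 1 by ring, qFact, Finset.prod_range_succ,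
      Finset.prod_range_succ]; rfl
  rw [e3, e4, e5, e6, e1, e2, e7]
  push_cast
  generalize qFactInv (s ^ 2) ((N : ℤ) + 1 + j) = u
  generalize qFactInv (s ^ 2) ((N : ℤ) + 1 - j) = v
  generalize qFact (s ^ 2) (2 * N) = f
  obtain ⟨x, hx⟩ : ∃ x, x = s ^ (j ^ 2) := ⟨_, rfl⟩
  obtain ⟨t, ht⟩ : ∃ t, t = s ^ j := ⟨_, rfl⟩
  obtain ⟨n, hn⟩ : ∃ n, n = s ^ N := ⟨_, rfl⟩
  have ht0 : t ≠ 0 := by rw [ht]; exact zpow_ne_zero _ hs0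
  have h1 : s ^ ((j - 1) ^ 2) = x * s / t ^ 2 := by
    rw [hx, ht, show (j - 1) ^ 2 = j ^ 2 + 1 - j * 2 by ring, zpow_sub₀ hs0, zpow_add₀ hs0,
      zpow_mul]; norm_cast
    simp
  have h2 : s ^ ((j + 1) ^ 2) = x * s * t ^ 2 := by
    rw [hx, ht, show (j + 1) ^ 2 = j ^ 2 + 1 + j * 2 by ring, zpow_add₀ hs0, zpow_add₀ hs0,
      zpow_mul]; norm_cast
    simp
  have h3 : (s ^ 2) ^ ((N : ℤ) + 1 + j) = n ^ 2 * s ^ 2 * t ^ 2 := by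
    rw [zpow_add₀ (pow_ne_zero 2 hs0), zpow_add₀ (pow_ne_zero 2 hs0), hn, ht, zpow_natCast,
      ← zpow_natCast (s ^ j), ← zpow_natCast s 2, ← zpow_mul s j, ← zpow_mul s _ j, mul_comm j]
    simp only [zpow_natCast, zpow_one]; ring
  have h4 : (s ^ 2) ^ ((N : ℤ) + 1 - j) = n ^ 2 * s ^ 2 / t ^ 2 := by
    rw [zpow_sub₀ (pow_ne_zero 2 hs0), zpow_add₀ (pow_ne_zero 2 hs0), hn, ht, zpow_natCast,
      ← zpow_natCast (s ^ j), ← zpow_natCast s 2, ← zpow_mul s j, ← zpow_mul s _ j, mul_comm j]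
    simp only [zpow_natCast, zpow_one]; ring
  have h5 : (s ^ 2) ^ ((N : ℤ) + j) = n ^ 2 * t ^ 2 := by
    rw [zpow_add₀ (pow_ne_zero 2 hs0), hn, ht, zpow_natCast,
      ← zpow_natCast (s ^ j), ← zpow_natCast s 2, ← zpow_mul s j, ← zpow_mul s _ j, mul_comm j]
    simp only [zpow_natCast]; ring
  have h6 : (s ^ 2) ^ ((N : ℤ) - j) = n ^ 2 / t ^ 2 := by
    rw [zpow_sub₀ (pow_ne_zero 2 hs0), hn, ht, zpow_natCast,
      ← zpow_natCast (s ^ j), ← zpow_natCast s 2, ← zpow_mul s j, ← zpow_mul s _ j, mul_comm j]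
    simp only [zpow_natCast]; ring
  have h7 : (s ^ 2) ^ (2 * N + 1) = n ^ 4 * s ^ 2 := by rw [hn]; ring
  have h8 : (s ^ 2) ^ (2 * N + 2) = n ^ 4 * s ^ 4 := by rw [hn]; ring
  have h9 : s ^ (4 * N + 2) = n ^ 4 * s ^ 2 := by rw [hn]; ring
  have h10 : s ^ (2 * N + 1) = n ^ 2 * s := by rw [hn]; ring
  rw [h1, h2, h3, h4, h5, h6, h7, h8, h9, h10, ← hx]
  field_simp
  ring

lemma hasSum_tripleCoeff {s w : ℂ} (hs0 : s ≠ 0) (hs : ‖s‖ < 1) (hw : w ≠ 0) (N : ℕ) :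
    HasSum (fun j : ℤ => tripleCoeff s N j * w ^ j)
      (∏ i ∈ Finset.range N, ((1 + s * w * (s ^ 2) ^ i) * (1 + s / w * (s ^ 2) ^ i))) := by
  induction N with
  | zero =>
    have h : ∀ j : ℤ, j ≠ 0 → tripleCoeff s 0 j * w ^ j = 0 := by
      intro j hj
      unfold tripleCoeff qFactInv
      rcases lt_or_gt_of_ne hj with h | h
      · rw [if_neg (by push_cast; omega)]; simp
      · rw [if_neg (c := 0 ≤ ((0 : ℕ) : ℤ) - j) (by push_cast; omega)]; simp
    convert hasSum_single (0 : ℤ) h using 1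
    simp [tripleCoeff, qFactInv, qFact]
  | succ N ih =>
    have h1 := (Equiv.hasSum_iff (Equiv.subRight (1 : ℤ))).2 ih
    have h2 := (Equiv.hasSum_iff (Equiv.addRight (1 : ℤ))).2 ih
    have h := (ih.mul_left (1 + s ^ (4 * N + 2))).add
      (((h1.mul_left w).add (h2.mul_left w⁻¹)).mul_left (s ^ (2 * N + 1)))
    rw [Finset.prod_range_succ]
    generalize (∏ i ∈ Finset.range N, ((1 + s * w * (s ^ 2) ^ i) * (1 + s / w * (s ^ 2) ^ i))) = P
      at h ⊢
    have hv : P * ((1 + s * w * (s ^ 2) ^ N) * (1 + s / w * (s ^ 2) ^ N)) =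
        (1 + s ^ (4 * N + 2)) * P + s ^ (2 * N + 1) * (w * P + w⁻¹ * P) := by
      rw [← pow_mul]
      field_simp
      ring
    rw [hv]
    refine hasSum_of_eq h fun j => ?_
    simp only [Function.comp_apply, Equiv.subRight_apply, Equiv.coe_addRight]
    rw [tripleCoeff_succ hs0 hs, zpow_sub₀ hw, zpow_add₀ hw, zpow_one]
    field_simp

lemma summable_triple {s w : ℂ} (hs0 : s ≠ 0) (hs : ‖s‖ < 1) (hw : w ≠ 0) :
    Summable fun j : ℤ => s ^ (j ^ 2) * w ^ j := by
  have hpi : (Real.pi : ℂ) * I ≠ 0 :=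
    mul_ne_zero (by exact_mod_cast Real.pi_ne_zero) I_ne_zero
  have key : 0 < (Complex.log s / (Real.pi * I)).im := by
    have : (Complex.log s / (Real.pi * I)).im = -Real.log ‖s‖ / Real.pi := by
      rw [div_mul_eq_div_div, div_I]
      simp [Complex.log_re, Complex.div_ofReal_re, neg_div]
    rw [this]
    exact div_pos (neg_pos.2 (Real.log_neg (norm_pos_iff.2 hs0) hs)) Real.pi_pos
  refine (hasSum_of_eq (hasSum_theta00 key (Complex.log w / (2 * Real.pi * I)))
    fun n => ?_).summable
  rw [Complex.exp_add]
  congr 1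
  · conv_rhs => rw [← Complex.exp_log hs0]
    rw [← Complex.exp_int_mul]
    congr 1
    push_cast
    field_simp
  · conv_rhs => rw [← Complex.exp_log hw]
    rw [← Complex.exp_int_mul]
    congr 1
    field_simp

theorem jacobi_triple_product {s w : ℂ} (hs0 : s ≠ 0) (hs : ‖s‖ < 1) (hw : w ≠ 0) :
    ∑' j : ℤ, s ^ (j ^ 2) * w ^ j =
      qProd (-s ^ 2) (s ^ 2) * (qProd (s * w) (s ^ 2) * qProd (s / w) (s ^ 2)) := by
  have hq := norm_sq_lt_one hs
  have hne := qProd_neg_self_ne_zero hq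
  obtain ⟨C1, hC1⟩ := qFact_bound hq
  obtain ⟨C2, hC20, hC2⟩ := qFactInv_bound hq
  have hC10 : 0 ≤ C1 := (norm_nonneg _).trans (hC1 0)
  have hsum := (summable_triple hs0 hs hw).norm.mul_left (C1 * C2 * C2)
  have hlim := tendsto_tsum_of_dominated_convergence (𝓕 := Filter.atTop)
    (f := fun (N : ℕ) (j : ℤ) => tripleCoeff s N j * w ^ j)
    (g := fun j : ℤ => (s ^ (j ^ 2) * w ^ j) * (qProd (-s ^ 2) (s ^ 2))⁻¹) hsum ?_ ?_
  · rw [tsum_mul_right] at hlim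
    have h2 := ((hasProd_qProd (s * w) hq).mul (hasProd_qProd (s / w) hq)).tendsto_prod_nat
    have h3 := tendsto_nhds_unique
      (h2.congr fun N => ((hasSum_tripleCoeff hs0 hs hw N).tsum_eq).symm)
      hlim
    rw [h3]
    field_simp
  · intro j
    have t1 : Filter.Tendsto (fun N : ℕ => qFact (s ^ 2) (2 * N)) Filter.atTop
        (nhds (qProd (-s ^ 2) (s ^ 2))) :=
      (tendsto_qFact hq).comp (Filter.tendsto_id.const_mul_atTop' two_pos)
    have t2 : Filter.Tendsto (fun N : ℕ => qFactInv (s ^ 2) (N + j)) Filter.atTop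
        (nhds (qProd (-s ^ 2) (s ^ 2))⁻¹) :=
      (tendsto_qFactInv hq).comp
        (Filter.tendsto_atTop_add_const_right _ _ tendsto_natCast_atTop_atTop)
    have t3 : Filter.Tendsto (fun N : ℕ => qFactInv (s ^ 2) (N - j)) Filter.atTop
        (nhds (qProd (-s ^ 2) (s ^ 2))⁻¹) :=
      (tendsto_qFactInv hq).comp
        (Filter.tendsto_atTop_add_const_right _ (-j) tendsto_natCast_atTop_atTop)
    have := (((t1.const_mul (s ^ (j ^ 2))).mul t2).mul t3).mul_const (w ^ j)
    refine this.congr' ?_ |>.trans (le_of_eq ?_)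
    · exact Filter.Eventually.of_forall fun N => rfl
    · congr 1; field_simp
  · refine Filter.Eventually.of_forall fun N j => ?_
    unfold tripleCoeff
    simp only [norm_mul]
    calc ‖s ^ (j ^ 2)‖ * ‖qFact (s ^ 2) (2 * N)‖ * ‖qFactInv (s ^ 2) (N + j)‖ *
        ‖qFactInv (s ^ 2) (N - j)‖ * ‖w ^ j‖ ≤ ‖s ^ (j ^ 2)‖ * C1 * C2 * C2 * ‖w ^ j‖ := by
          gcongr
          · exact hC1 _
          · exact hC2 _
          · exact hC2 _
      _ = _ := by ring

lemma norm_exp_pi_lt_one {τ : ℂ} (hτ : 0 < τ.im) : ‖cexp ((Real.pi : ℂ) * I * τ)‖ < 1 := by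
  rw [Complex.norm_exp]
  simp only [mul_re, mul_im, ofReal_re, ofReal_im, I_re, I_im]
  rw [Real.exp_lt_one_iff]
  nlinarith [Real.pi_pos, mul_pos Real.pi_pos hτ]

lemma qC_eq_sq (τ : ℂ) : qC τ = cexp ((Real.pi : ℂ) * I * τ) ^ 2 := by
  rw [qC, e2, ← Complex.exp_nat_mul]
  congr 1; push_cast; ring

lemma norm_qC_lt_one {τ : ℂ} (hτ : 0 < τ.im) : ‖qC τ‖ < 1 := by
  rw [qC_eq_sq]; exact norm_sq_lt_one (norm_exp_pi_lt_one hτ)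

lemma theta00_eq_qProd {τ : ℂ} (hτ : 0 < τ.im) (z : ℂ) : theta00 τ z =
    qProd (-qC τ) (qC τ) * (qProd (cexp ((Real.pi : ℂ) * I * τ) * e2 z) (qC τ) *
      qProd (cexp ((Real.pi : ℂ) * I * τ) / e2 z) (qC τ)) := by
  rw [qC_eq_sq, ← jacobi_triple_product (Complex.exp_ne_zero _) (norm_exp_pi_lt_one hτ)
    (show e2 z ≠ 0 from Complex.exp_ne_zero _), theta00]
  refine tsum_congr fun n => ?_
  rw [e2, ← Complex.exp_int_mul, ← Complex.exp_int_mul, ← Complex.exp_add]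
  congr 1; push_cast; ring

lemma theta10_eq_qProd {τ : ℂ} (hτ : 0 < τ.im) (z : ℂ) : theta10 τ z =
    cexp ((Real.pi : ℂ) * I * τ / 4 + (Real.pi : ℂ) * I * z) * (qProd (-qC τ) (qC τ) *
      (qProd (qC τ * e2 z) (qC τ) * ((1 + 1 / e2 z) * qProd (qC τ / e2 z) (qC τ)))) := by
  have h1 : e2 (z + τ / 2) = cexp ((Real.pi : ℂ) * I * τ) * e2 z := by
    rw [e2, e2, ← Complex.exp_add]; congr 1; ring
  have h0 : e2 z ≠ 0 := Complex.exp_ne_zero _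
  have h2 : cexp ((Real.pi : ℂ) * I * τ) ≠ 0 := Complex.exp_ne_zero _
  rw [theta10_eq, theta00_eq_qProd hτ, h1, div_mul_eq_div_div, div_self h2,
    qProd_succ (1 / e2 z) (norm_qC_lt_one hτ), ← mul_assoc _ _ (e2 z), ← sq, ← qC_eq_sq,
    one_div_mul_eq_div]

lemma theta_eq_qProd {τ : ℂ} (hτ : 0 < τ.im) (z : ℂ) : theta τ z =
    cexp ((Real.pi : ℂ) * I * τ / 4) *
    (cexp ((Real.pi : ℂ) * I * z) - cexp (-((Real.pi : ℂ) * I * z))) *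
    (qProd (-qC τ * e2 z) (qC τ) * qProd (-qC τ / e2 z) (qC τ) * qProd (-qC τ) (qC τ)) := by
  rw [theta]
  congr 1
  have hq := norm_qC_lt_one hτ
  refine Eq.trans (tprod_congr fun n => ?_) (((hasProd_qProd (-qC τ * e2 z) hq).mul
    (hasProd_qProd (-qC τ / e2 z) hq)).mul (hasProd_qProd (-qC τ) hq)).tprod_eq
  rw [zetaC, pow_succ]
  ring

lemma theta_sq {τ : ℂ} (hτ : 0 < τ.im) (z : ℂ) : theta τ z ^ 2 = -theta10 τ (z + 1 / 2) ^ 2 := by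
  have h : theta10 τ (z + 1 / 2) = I * theta τ z := by
    have h1 : e2 (z + 1 / 2) = -e2 z := by
      rw [e2, e2, mul_add, Complex.exp_add,
        show 2 * (Real.pi : ℂ) * I * (1 / 2) = Real.pi * I by ring, Complex.exp_pi_mul_I]
      ring
    have h2 : cexp ((Real.pi : ℂ) * I * τ / 4 + (Real.pi : ℂ) * I * (z + 1 / 2)) =
        I * cexp ((Real.pi : ℂ) * I * τ / 4) * cexp ((Real.pi : ℂ) * I * z) := by
      rw [mul_add, Complex.exp_add, Complex.exp_add,
        show (Real.pi : ℂ) * I * (1 / 2) = Real.pi / 2 * I by ring, Complex.exp_pi_div_two_mul_I]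
      ring
    have h3 : e2 z = cexp ((Real.pi : ℂ) * I * z) ^ 2 := by
      rw [e2, ← Complex.exp_nat_mul]
      congr 1; push_cast; ring
    have h0 : cexp ((Real.pi : ℂ) * I * z) ≠ 0 := Complex.exp_ne_zero _
    rw [theta10_eq_qProd hτ, theta_eq_qProd hτ, h1, h2, Complex.exp_neg,
      show qC τ * -e2 z = -qC τ * e2 z by ring, show qC τ / -e2 z = -qC τ / e2 z by
        rw [div_neg, neg_div],
      show (1 + 1 / -e2 z) = 1 - 1 / e2 z by rw [div_neg, sub_eq_add_neg]]
    have h4 : cexp ((Real.pi : ℂ) * I * z) * (1 - 1 / e2 z) =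
        cexp ((Real.pi : ℂ) * I * z) - (cexp ((Real.pi : ℂ) * I * z))⁻¹ := by
      rw [h3]; field_simp
    rw [← h4]
    ring
  rw [h, mul_pow, I_sq]; ring

lemma e2_zero : e2 0 = 1 := by simp [e2]

lemma theta_null_product {τ : ℂ} (hτ : 0 < τ.im) :
    theta00 τ 0 * theta01 τ 0 * theta10 τ 0 = 2 * eta τ ^ 3 := by
  have hq := norm_qC_lt_one hτ
  have hs := norm_exp_pi_lt_one hτ
  have h1 : e2 (0 + 1 / 2) = -1 := by
    rw [e2, show 2 * (Real.pi : ℂ) * I * (0 + 1 / 2) = Real.pi * I by ring, Complex.exp_pi_mul_I]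
  have he := euler_odd_distinct hq
  have hm := qProd_mul_neg (cexp ((Real.pi : ℂ) * I * τ)) hq
  have heta : eta τ = cexp ((Real.pi : ℂ) * I * τ / 12) * qProd (-qC τ) (qC τ) := by
    rw [eta, qProd]; congr 1
    exact tprod_congr fun n => by ring
  rw [← qC_eq_sq] at hm
  rw [theta01_eq, theta00_eq_qProd hτ, theta00_eq_qProd hτ, theta10_eq_qProd hτ, heta, h1, e2_zero,
    mul_pow, ← Complex.exp_nat_mul,
    show ((3 : ℕ) : ℂ) * ((Real.pi : ℂ) * I * τ / 12) =
      (Real.pi : ℂ) * I * τ / 4 + (Real.pi : ℂ) * I * 0 by push_cast; ring]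
  simp only [mul_one, div_one, mul_neg, div_neg]
  generalize cexp ((Real.pi : ℂ) * I * τ / 4 + (Real.pi : ℂ) * I * 0) = ε
  generalize qProd (cexp ((Real.pi : ℂ) * I * τ)) (qC τ) = a at *
  generalize qProd (-cexp ((Real.pi : ℂ) * I * τ)) (qC τ) = b at *
  generalize qProd (-qC τ) (qC τ) = P at *
  generalize qProd (qC τ) (qC τ) = c at *
  rw [← hm] at he
  linear_combination 2 * ε * P ^ 3 * (a * b * c + 1) * he

/-- The filter of neighbourhoods of `i∞` in a vertical strip. -/
def stripInfty : Filter ℂ :=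
  Filter.comap Complex.im Filter.atTop ⊓ Filter.principal {τ | |τ.re| ≤ 1}

lemma periodic_int {F : ℂ → ℂ} (hT : ∀ τ : ℂ, 0 < τ.im → F (τ + 1) = F τ) (n : ℤ) :
    ∀ τ : ℂ, 0 < τ.im → F (τ + n) = F τ := by
  induction n using Int.induction_on with
  | zero => simp
  | succ n ih =>
    intro τ hτ
    rw [← ih τ hτ, ← hT (τ + (n : ℤ)) (by simpa using hτ)]
    congr 1; push_cast; ring
  | pred n ih =>
    intro τ hτ
    rw [← ih τ hτ, ← hT (τ + ((-n - 1 : ℤ) : ℂ)) (by simpa using hτ)]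
    congr 1; push_cast; ring

lemma tendsto_atImInfty_of_strip {F : ℂ → ℂ} (hT : ∀ τ : ℂ, 0 < τ.im → F (τ + 1) = F τ) {a : ℂ}
    (hlim : Filter.Tendsto F stripInfty (nhds a)) :
    Filter.Tendsto (fun τ : UpperHalfPlane => F τ) UpperHalfPlane.atImInfty (nhds a) := by
  intro s hs
  have h := hlim hs
  rw [Filter.mem_map, stripInfty, Filter.mem_inf_principal, Filter.mem_comap] at h
  obtain ⟨t, ht, hts⟩ := h
  obtain ⟨Y, hY⟩ := Filter.mem_atTop_sets.1 ht
  rw [Filter.mem_map, UpperHalfPlane.atImInfty_mem]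
  refine ⟨Y, fun z hz => ?_⟩
  have h1 : (z : ℂ) + ((-round z.re : ℤ) : ℂ) ∈ F ⁻¹' s := by
    refine hts (a := (z : ℂ) + ((-round z.re : ℤ) : ℂ)) (by simpa using hY _ hz) ?_
    simp only [Set.mem_ofPred_eq, add_re, UpperHalfPlane.coe_re, intCast_re]
    have := abs_sub_round z.re
    push_cast
    rw [← sub_eq_add_neg]
    linarith
  rw [Set.mem_preimage, periodic_int hT _ _ z.im_pos] at h1
  exact h1

open UpperHalfPlane ModularForm in
lemma levelOne_eq_zero {k : ℕ} (hk : k < 12) {F : ℂ → ℂ}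
    (hd : ∀ τ : ℂ, 0 < τ.im → DifferentiableAt ℂ F τ)
    (hT : ∀ τ : ℂ, 0 < τ.im → F (τ + 1) = F τ)
    (hS : ∀ τ : ℂ, 0 < τ.im → F (-1 / τ) = τ ^ k * F τ)
    (hlim : Filter.Tendsto F stripInfty (nhds 0)) :
    ∀ τ : ℂ, 0 < τ.im → F τ = 0 := by
  have hlim' := tendsto_atImInfty_of_strip hT hlim
  set f : ℍ → ℂ := fun z => F z with hf
  have hfT : f ∣[(k : ℤ)] ModularGroup.T = f := by
    ext z
    have h1 : denom ModularGroup.T z = 1 := by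
      rw [ModularGroup.denom_apply]; simp [ModularGroup.T]
    rw [SL_slash_apply, h1, modular_T_smul, hf]
    simp [add_comm, hT _ z.im_pos]
  have hfS : f ∣[(k : ℤ)] ModularGroup.S = f := by
    ext z
    rw [SL_slash_apply, ModularGroup.denom_S, modular_S_smul]
    change F ((-(z : ℂ))⁻¹) * _ = F z
    rw [show (-(z : ℂ))⁻¹ = -1 / (z : ℂ) by rw [inv_neg, neg_div, one_div], hS _ z.im_pos,
      zpow_neg, zpow_natCast]
    field_simp [z.ne_zero]
  let c : CuspForm (MonoidHom.range (Matrix.SpecialLinearGroup.mapGL ℝ :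
      Matrix.SpecialLinearGroup (Fin 2) ℤ →* _)) k :=
    { toFun := f
      slash_action_eq' := by
        rintro _ ⟨A, rfl⟩
        exact SlashInvariantForm.slash_action_generators_SL2Z hfS hfT A
      holo' := by
        rw [UpperHalfPlane.mdifferentiable_iff]
        refine .congr (fun z hz ↦ (hd z hz).differentiableWithinAt) fun z hz ↦ ?_
        simp [hf, ofComplex_apply_of_im_pos hz]
      zero_at_cusps' := by
        intro c hc
        rw [Subgroup.IsArithmetic.isCusp_iff_isCusp_SL2Z] at hc
        rw [OnePoint.isZeroAt_iff_forall_SL2Z hc]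
        intro γ _
        rw [SlashInvariantForm.slash_action_generators_SL2Z hfS hfT]
        exact hlim' }
  have hr := CuspForm.rank_eq_zero_of_weight_lt_twelve (k := (k : ℤ)) (by exact_mod_cast hk)
  have hc : c = 0 := by
    have := rank_zero_iff.1 hr
    exact Subsingleton.elim _ _
  intro τ hτ
  exact congrArg (fun g : CuspForm _ _ => g ⟨τ, hτ⟩) hc

section EisensteinFacts

open UpperHalfPlane ModularForm

lemma Eis_eq_E {k : ℕ} (hk : 3 ≤ k) (hk2 : Even k) {τ : ℂ} (hτ : 0 < τ.im) :
    Eis k τ = ModularForm.E hk ⟨τ, hτ⟩ := by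
  have h := ModularForm.hasSum_qExpansion (h := 1) (ModularForm.E hk) one_pos
    one_mem_strictPeriods_SL ⟨τ, hτ⟩
  rw [← h.tsum_eq, h.summable.tsum_eq_zero_add, EisensteinSeries.E_qExpansion_coeff_zero hk hk2,
    Eis, ← tsum_mul_left, sub_eq_add_neg, ← tsum_neg]
  congr 1
  · simp
  · refine tsum_congr fun n => ?_
    rw [EisensteinSeries.E_qExpansion_coeff hk hk2, if_neg n.succ_ne_zero]
    have h1 : Function.Periodic.qParam 1 τ = qC τ := by
      simp [Function.Periodic.qParam, qC, e2]
    rw [show ((⟨τ, hτ⟩ : UpperHalfPlane) : ℂ) = τ from rfl, h1, sigma',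
      ArithmeticFunction.sigma_apply]
    ring

lemma Eis_add_one (k : ℕ) (τ : ℂ) : Eis k (τ + 1) = Eis k τ := by
  have : qC (τ + 1) = qC τ := by
    rw [qC, qC, e2, e2, mul_add, mul_one, Complex.exp_add, Complex.exp_two_pi_mul_I, mul_one]
  rw [Eis, Eis, this]

lemma neg_one_div_im_pos {τ : ℂ} (hτ : 0 < τ.im) : 0 < (-1 / τ).im := by
  have := UpperHalfPlane.im_inv_neg_coe_pos ⟨τ, hτ⟩
  rw [show -1 / τ = (-τ)⁻¹ by rw [inv_neg, neg_div, one_div]]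
  exact this

lemma Eis_neg_inv {k : ℕ} (hk : 3 ≤ k) (hk2 : Even k) {τ : ℂ} (hτ : 0 < τ.im) :
    Eis k (-1 / τ) = τ ^ k * Eis k τ := by
  have h : (ModularForm.E hk : UpperHalfPlane → ℂ) ∣[(k : ℤ)] ModularGroup.S = ModularForm.E hk :=
    SlashInvariantFormClass.slash_action_eq (ModularForm.E hk) _ ⟨ModularGroup.S, rfl⟩
  have h2 := congrFun h ⟨τ, hτ⟩
  rw [SL_slash_apply, ModularGroup.denom_S, modular_S_smul, zpow_neg, zpow_natCast] at h2
  rw [Eis_eq_E hk hk2 hτ, Eis_eq_E hk hk2 (neg_one_div_im_pos hτ), ← h2]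
  have h3 : (⟨-1 / τ, neg_one_div_im_pos hτ⟩ : UpperHalfPlane) = ⟨(-τ)⁻¹,
      UpperHalfPlane.im_inv_neg_coe_pos ⟨τ, hτ⟩⟩ := by
    ext; simp [inv_neg, neg_div]
  have h4 : τ ≠ 0 := by rintro rfl; simp at hτ
  rw [h3]
  field_simp

lemma differentiableAt_Eis {k : ℕ} (hk : 3 ≤ k) (hk2 : Even k) {τ : ℂ} (hτ : 0 < τ.im) :
    DifferentiableAt ℂ (Eis k) τ := by
  have h := UpperHalfPlane.mdifferentiable_iff.1 (ModularFormClass.holo (ModularForm.E hk))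
  have h1 := (h τ hτ).differentiableAt (isOpen_upperHalfPlaneSet.mem_nhds hτ)
  refine h1.congr_of_eventuallyEq ?_
  filter_upwards [isOpen_upperHalfPlaneSet.mem_nhds hτ] with w hw
  rw [Function.comp_apply, ofComplex_apply_of_im_pos hw, Eis_eq_E hk hk2 hw]

lemma eventually_stripInfty_im (Y : ℝ) : ∀ᶠ τ in stripInfty, Y < τ.im :=
  (inf_le_left : stripInfty ≤ _) (Filter.tendsto_comap.eventually (Filter.eventually_gt_atTop Y))

lemma eventually_stripInfty_re : ∀ᶠ τ in stripInfty, |τ.re| ≤ 1 :=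
  (inf_le_right : stripInfty ≤ _) (Filter.mem_principal_self _)

lemma tendsto_im_stripInfty : Filter.Tendsto Complex.im stripInfty Filter.atTop :=
  Filter.tendsto_comap.mono_left inf_le_left

lemma tendsto_Eis {k : ℕ} (hk : 3 ≤ k) (hk2 : Even k) :
    Filter.Tendsto (Eis k) stripInfty (nhds 1) := by
  have hv : valueAtInfty (ModularForm.E hk) = 1 := by
    rw [← UpperHalfPlane.qExpansion_coeff_zero one_pos
        (ModularFormClass.analyticAt_cuspFunction_zero (ModularForm.E hk) one_pos
          one_mem_strictPeriods_SL)
        (SlashInvariantFormClass.periodic_comp_ofComplex (ModularForm.E hk)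
          one_mem_strictPeriods_SL),
      EisensteinSeries.E_qExpansion_coeff_zero hk hk2]
  obtain ⟨c, hc, h⟩ := ModularFormClass.exp_decay_sub_atImInfty' (ModularForm.E hk)
  rw [hv] at h
  have h1 : Filter.Tendsto (fun τ : UpperHalfPlane => Real.exp (-c * τ.im)) atImInfty (nhds 0) := by
    refine Real.tendsto_exp_atBot.comp ?_
    exact (Filter.tendsto_comap (f := UpperHalfPlane.im)).const_mul_atTop_of_neg (neg_lt_zero.2 hc)
  have h2 := (h.trans_tendsto h1).add_const 1
  simp only [sub_add_cancel, zero_add] at h2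
  have h3 : Filter.Tendsto ofComplex stripInfty atImInfty :=
    tendsto_comap_im_ofComplex.mono_left inf_le_left
  refine (h2.comp h3).congr' ?_
  filter_upwards [eventually_stripInfty_im 0] with τ hτ
  rw [Function.comp_apply, ofComplex_apply_of_im_pos hτ, Eis_eq_E hk hk2 hτ]

end EisensteinFacts

lemma ne_zero_of_im_pos {τ : ℂ} (hτ : 0 < τ.im) : τ ≠ 0 := by
  rintro rfl; simp at hτ

lemma theta00_add_one_tau (τ z : ℂ) : theta00 (τ + 1) z = theta01 τ z := by
  rw [theta01_eq]
  refine tsum_congr fun n => ?_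
  obtain ⟨k, hk⟩ := Int.even_mul_pred_self n
  have hk' : (n : ℂ) * (n - 1) = 2 * k := by
    have : n * (n - 1) = 2 * k := by rw [hk]; ring
    exact_mod_cast this
  rw [Complex.exp_eq_exp_iff_exists_int]
  exact ⟨k, by linear_combination (Real.pi : ℂ) * I * hk'⟩

lemma theta01_add_one_tau (τ z : ℂ) : theta01 (τ + 1) z = theta00 τ z := by
  rw [theta01_eq, theta00_add_one_tau, theta01_eq, show z + 1 / 2 + 1 / 2 = z + 1 by ring,
    theta00_add_one]

lemma theta10_add_one_tau (τ z : ℂ) :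
    theta10 (τ + 1) z = cexp ((Real.pi : ℂ) * I / 4) * theta10 τ z := by
  rw [theta10_eq, theta10_eq, theta00_add_one_tau, theta01_eq,
    show z + (τ + 1) / 2 + 1 / 2 = z + τ / 2 + 1 by ring, theta00_add_one, ← mul_assoc,
    ← Complex.exp_add]
  congr 2; ring

/-- The automorphy factor `(-iτ)^{1/2}` of the theta functions. -/
def thetaFactor (τ : ℂ) : ℂ := (-I * τ) ^ (1 / 2 : ℂ)

lemma thetaFactor_ne_zero {τ : ℂ} (hτ : 0 < τ.im) : thetaFactor τ ≠ 0 := by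
  have := ne_zero_of_im_pos hτ
  simp [thetaFactor, Complex.cpow_eq_zero_iff, this]

lemma thetaFactor_pow_four (τ : ℂ) : thetaFactor τ ^ 4 = -τ ^ 2 := by
  have : thetaFactor τ ^ 2 = -I * τ := by
    rw [thetaFactor, ← Complex.cpow_nat_mul]; simp
  rw [show thetaFactor τ ^ 4 = (thetaFactor τ ^ 2) ^ 2 by ring, this, mul_pow, neg_sq, I_sq]
  ring

lemma theta00_neg_inv {τ : ℂ} (hτ : 0 < τ.im) (z : ℂ) : theta00 (-1 / τ) (z / τ) =
    thetaFactor τ * cexp ((Real.pi : ℂ) * I * z ^ 2 / τ) * theta00 τ z := by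
  have h := jacobiTheta₂_functional_equation z τ
  have hk := thetaFactor_ne_zero hτ
  have he := Complex.exp_ne_zero ((Real.pi : ℂ) * I * z ^ 2 / τ)
  rw [show -(Real.pi : ℂ) * I * z ^ 2 / τ = -((Real.pi : ℂ) * I * z ^ 2 / τ) by ring,
    Complex.exp_neg, ← thetaFactor] at h
  rw [theta00_eq, theta00_eq, h]
  generalize cexp ((Real.pi : ℂ) * I * z ^ 2 / τ) = e at *
  generalize jacobiTheta₂ (z / τ) (-1 / τ) = j
  field_simp

lemma theta01_neg_inv {τ : ℂ} (hτ : 0 < τ.im) (z : ℂ) : theta01 (-1 / τ) (z / τ) =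
    thetaFactor τ * cexp ((Real.pi : ℂ) * I * z ^ 2 / τ) * theta10 τ z := by
  have := ne_zero_of_im_pos hτ
  rw [theta01_eq, show z / τ + 1 / 2 = (z + τ / 2) / τ by field_simp, theta00_neg_inv hτ,
    theta10_eq, ← mul_assoc, mul_assoc (thetaFactor τ) _ (cexp _), ← Complex.exp_add]
  congr 3
  field_simp; ring

lemma theta10_neg_inv {τ : ℂ} (hτ : 0 < τ.im) (z : ℂ) : theta10 (-1 / τ) (z / τ) =
    thetaFactor τ * cexp ((Real.pi : ℂ) * I * z ^ 2 / τ) * theta01 τ z := by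
  have := ne_zero_of_im_pos hτ
  rw [theta10_eq, show z / τ + -1 / τ / 2 = (z - 1 / 2) / τ by field_simp; ring,
    theta00_neg_inv hτ, theta01_eq, show z + 1 / 2 = z - 1 / 2 + 1 by ring, theta00_add_one,
    mul_left_comm, ← mul_assoc, mul_assoc (thetaFactor τ), ← Complex.exp_add]
  congr 3
  field_simp; ring

section Nullwerte

variable {τ : ℂ}

lemma theta_null_neg_inv (hτ : 0 < τ.im) :
    theta00 (-1 / τ) 0 = thetaFactor τ * theta00 τ 0 ∧
    theta01 (-1 / τ) 0 = thetaFactor τ * theta10 τ 0 ∧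
    theta10 (-1 / τ) 0 = thetaFactor τ * theta01 τ 0 := by
  have h0 := theta00_neg_inv hτ 0
  have h1 := theta01_neg_inv hτ 0
  have h2 := theta10_neg_inv hτ 0
  simp only [zero_div, ne_eq, OfNat.ofNat_ne_zero, not_false_eq_true, zero_pow, mul_zero,
    Complex.exp_zero, mul_one] at h0 h1 h2
  exact ⟨h0, h1, h2⟩

lemma eta_ne_zero (hτ : 0 < τ.im) : eta τ ≠ 0 := by
  have h : eta τ = cexp ((Real.pi : ℂ) * I * τ / 12) * qProd (-qC τ) (qC τ) := by
    simp [eta, qProd, pow_succ', sub_eq_add_neg]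
  rw [h]
  exact mul_ne_zero (Complex.exp_ne_zero _) (qProd_neg_self_ne_zero (norm_qC_lt_one hτ))

lemma theta_null_ne_zero (hτ : 0 < τ.im) :
    theta00 τ 0 ≠ 0 ∧ theta01 τ 0 ≠ 0 ∧ theta10 τ 0 ≠ 0 := by
  have h := theta_null_product hτ
  have h1 : theta00 τ 0 * theta01 τ 0 * theta10 τ 0 ≠ 0 := by
    rw [h]; exact mul_ne_zero two_ne_zero (pow_ne_zero _ (eta_ne_zero hτ))
  rw [mul_ne_zero_iff, mul_ne_zero_iff] at h1
  exact ⟨h1.1.1, h1.1.2, h1.2⟩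

lemma differentiableAt_theta00_null (hτ : 0 < τ.im) :
    DifferentiableAt ℂ (fun τ => theta00 τ 0) τ := by
  simp only [theta00_eq]
  exact differentiableAt_jacobiTheta₂_snd 0 hτ

lemma differentiableAt_theta01_null (hτ : 0 < τ.im) :
    DifferentiableAt ℂ (fun τ => theta01 τ 0) τ := by
  simp only [theta01_eq, theta00_eq]
  exact differentiableAt_jacobiTheta₂_snd _ hτ

lemma tendsto_theta00_null_comap :
    Filter.Tendsto (fun τ => theta00 τ 0) (Filter.comap Complex.im Filter.atTop) (nhds 1) := by
  have h : Filter.Tendsto (fun τ : ℂ => Real.exp (-Real.pi * τ.im))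
      (Filter.comap Complex.im Filter.atTop) (nhds 0) := by
    refine Real.tendsto_exp_atBot.comp ?_
    exact Filter.tendsto_comap.const_mul_atTop_of_neg (neg_lt_zero.2 Real.pi_pos)
  have h2 := (isBigO_at_im_infty_jacobiTheta_sub_one.trans_tendsto h).add_const 1
  simpa [theta00_eq, jacobiTheta_eq_jacobiTheta₂] using h2

lemma tendsto_theta00_null : Filter.Tendsto (fun τ => theta00 τ 0) stripInfty (nhds 1) :=
  tendsto_theta00_null_comap.mono_left inf_le_left

lemma tendsto_theta01_null : Filter.Tendsto (fun τ => theta01 τ 0) stripInfty (nhds 1) := by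
  simp only [← theta00_add_one_tau]
  refine tendsto_theta00_null_comap.comp (Filter.tendsto_comap_iff.2 ?_)
  simpa [Function.comp_def] using tendsto_im_stripInfty

end Nullwerte

/-- `ϑ₀₀(τ,0)⁴`. -/
def quart00 (τ : ℂ) : ℂ := theta00 τ 0 ^ 4

/-- `ϑ₀₁(τ,0)⁴`. -/
def quart01 (τ : ℂ) : ℂ := theta01 τ 0 ^ 4

lemma theta10_pow_four {τ : ℂ} (hτ : 0 < τ.im) : theta10 τ 0 ^ 4 = quart00 τ - quart01 τ := by
  rw [quart00, quart01, jacobi_quartic hτ]; ring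

lemma quart00_add_one (τ : ℂ) : quart00 (τ + 1) = quart01 τ := by
  rw [quart00, theta00_add_one_tau, quart01]

lemma quart01_add_one (τ : ℂ) : quart01 (τ + 1) = quart00 τ := by
  rw [quart01, theta01_add_one_tau, quart00]

lemma quart00_neg_inv {τ : ℂ} (hτ : 0 < τ.im) : quart00 (-1 / τ) = -τ ^ 2 * quart00 τ := by
  rw [quart00, (theta_null_neg_inv hτ).1, mul_pow, thetaFactor_pow_four, quart00]

lemma quart01_neg_inv {τ : ℂ} (hτ : 0 < τ.im) :
    quart01 (-1 / τ) = -τ ^ 2 * (quart00 τ - quart01 τ) := by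
  rw [quart01, (theta_null_neg_inv hτ).2.1, mul_pow, thetaFactor_pow_four, theta10_pow_four hτ]

lemma differentiableAt_quart00 {τ : ℂ} (hτ : 0 < τ.im) : DifferentiableAt ℂ quart00 τ :=
  (differentiableAt_theta00_null hτ).pow 4

lemma differentiableAt_quart01 {τ : ℂ} (hτ : 0 < τ.im) : DifferentiableAt ℂ quart01 τ :=
  (differentiableAt_theta01_null hτ).pow 4

lemma tendsto_quart00 : Filter.Tendsto quart00 stripInfty (nhds 1) := by
  simpa [quart00] using! tendsto_theta00_null.pow 4

lemma tendsto_quart01 : Filter.Tendsto quart01 stripInfty (nhds 1) := by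
  simpa [quart01] using! tendsto_theta01_null.pow 4

lemma Eis_four_eq {τ : ℂ} (hτ : 0 < τ.im) :
    Eis 4 τ = quart00 τ ^ 2 + quart01 τ ^ 2 - quart00 τ * quart01 τ := by
  have h4 : Even 4 := by decide
  refine sub_eq_zero.1 (levelOne_eq_zero (k := 4) (by norm_num) (F := fun τ => Eis 4 τ -
    (quart00 τ ^ 2 + quart01 τ ^ 2 - quart00 τ * quart01 τ)) ?_ ?_ ?_ ?_ τ hτ)
  · intro τ hτ
    have h0 := differentiableAt_quart00 hτ
    have h1 := differentiableAt_quart01 hτ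
    have h2 := differentiableAt_Eis (k := 4) (by norm_num) h4 hτ
    fun_prop
  · intro τ hτ
    simp only [Eis_add_one, quart00_add_one, quart01_add_one]; ring
  · intro τ hτ
    simp only [Eis_neg_inv (k := 4) (by norm_num) h4 hτ, quart00_neg_inv hτ, quart01_neg_inv hτ]
    ring
  · have := (tendsto_Eis (k := 4) (by norm_num) h4).sub (((tendsto_quart00.pow 2).add
      (tendsto_quart01.pow 2)).sub (tendsto_quart00.mul tendsto_quart01))
    simpa using this

lemma Eis_six_eq {τ : ℂ} (hτ : 0 < τ.im) : Eis 6 τ = 1 / 2 * ((quart00 τ + quart01 τ) *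
    (2 * quart00 τ - quart01 τ) * (2 * quart01 τ - quart00 τ)) := by
  have h4 : Even 6 := by decide
  refine sub_eq_zero.1 (levelOne_eq_zero (k := 6) (by norm_num) (F := fun τ => Eis 6 τ -
    1 / 2 * ((quart00 τ + quart01 τ) *
    (2 * quart00 τ - quart01 τ) * (2 * quart01 τ - quart00 τ))) ?_ ?_ ?_ ?_ τ hτ)
  · intro τ hτ
    have h0 := differentiableAt_quart00 hτ
    have h1 := differentiableAt_quart01 hτ
    have h2 := differentiableAt_Eis (k := 6) (by norm_num) h4 hτ
    fun_prop
  · intro τ hτ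
    simp only [Eis_add_one, quart00_add_one, quart01_add_one]; ring
  · intro τ hτ
    simp only [Eis_neg_inv (k := 6) (by norm_num) h4 hτ, quart00_neg_inv hτ, quart01_neg_inv hτ]
    ring
  · have := (tendsto_Eis (k := 6) (by norm_num) h4).sub ((((tendsto_quart00.add
      tendsto_quart01).mul ((tendsto_quart00.const_mul 2).sub tendsto_quart01)).mul
      ((tendsto_quart01.const_mul 2).sub tendsto_quart00)).const_mul (1 / 2))
    norm_num at this
    simpa using this

lemma jacobiTheta₂_add_two_mul_int (z τ : ℂ) (n : ℤ) :
    jacobiTheta₂ z (τ + 2 * n) = jacobiTheta₂ z τ := by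
  rw [jacobiTheta₂, jacobiTheta₂]
  refine tsum_congr fun l => ?_
  rw [jacobiTheta₂_term, jacobiTheta₂_term, Complex.exp_eq_exp_iff_exists_int]
  exact ⟨l ^ 2 * n, by push_cast; ring⟩

lemma isCoprime_denom_ne_zero {c d : ℤ} (h : IsCoprime c d) {τ : ℂ} (hτ : 0 < τ.im) :
    (c : ℂ) * τ + d ≠ 0 := by
  intro h0
  have h1 := congrArg Complex.im h0
  simp only [add_im, mul_im, intCast_re, intCast_im, zero_mul, add_zero, zero_im, mul_eq_zero,
    Int.cast_eq_zero, hτ.ne', or_false] at h1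
  subst h1
  simp only [Int.cast_zero, zero_mul, zero_add, Int.cast_eq_zero] at h0
  subst h0
  exact not_isCoprime_zero_zero h

lemma bezout_spec {c d : ℤ} (h : IsCoprime c d) :
    (bezout c d).1 * d - (bezout c d).2 * c = 1 := by
  have h1 : ∃ ab : ℤ × ℤ, ab.1 * d - ab.2 * c = 1 := by
    obtain ⟨u, v, huv⟩ := h
    exact ⟨(v, -u), by simp only; linarith⟩
  rw [bezout, dif_pos h1]
  exact h1.choose_spec

lemma EisJSummand_bezout (k m : ℕ) (τ z : ℂ) (c d : ℤ) : EisJSummand k m τ z c d =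
    ((c : ℂ) * τ + d) ^ (-(k : ℤ)) * (e2 (-(m * (c * z ^ 2 / (c * τ + d)))) *
      jacobiTheta₂ (2 * m * (z / (c * τ + d)))
        (2 * m * (((bezout c d).1 * τ + (bezout c d).2) / (c * τ + d)))) := by
  rw [EisJSummand]
  congr 1
  rw [jacobiTheta₂, ← tsum_mul_left]
  refine tsum_congr fun l => ?_
  rw [e2, e2, jacobiTheta₂_term, ← Complex.exp_add]
  congr 1
  ring

lemma EisJSummand_eq (k m : ℕ) {τ : ℂ} (hτ : 0 < τ.im) (z : ℂ) {a b c d : ℤ}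
    (h : a * d - b * c = 1) : EisJSummand k m τ z c d =
    ((c : ℂ) * τ + d) ^ (-(k : ℤ)) * (e2 (-(m * (c * z ^ 2 / (c * τ + d)))) *
      jacobiTheta₂ (2 * m * (z / (c * τ + d))) (2 * m * ((a * τ + b) / (c * τ + d)))) := by
  have hc : IsCoprime c d := ⟨-b, a, by linarith⟩
  have h0 := isCoprime_denom_ne_zero hc hτ
  have hb := bezout_spec hc
  rw [EisJSummand_bezout]
  congr 2
  set a' := (bezout c d).1
  set b' := (bezout c d).2
  have h1 : a' = a + (a * b' - b * a') * c := by linear_combination a * hb - a' * h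
  have h2 : b' = b + (a * b' - b * a') * d := by linear_combination b * hb - b' * h
  generalize a * b' - b * a' = n at h1 h2
  rw [h1, h2, ← jacobiTheta₂_add_two_mul_int _ (2 * m * ((a * τ + b) / (c * τ + d))) (m * n)]
  congr 1
  push_cast
  field_simp
  ring

lemma EisJSummand_add_one (k m : ℕ) {τ : ℂ} (hτ : 0 < τ.im) (z : ℂ) {c d : ℤ}
    (h : IsCoprime c d) : EisJSummand k m (τ + 1) z c d = EisJSummand k m τ z c (c + d) := by
  have hb := bezout_spec h
  rw [EisJSummand_bezout, EisJSummand_eq k m hτ z (a := (bezout c d).1)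
    (b := (bezout c d).1 + (bezout c d).2) (by linarith)]
  push_cast
  rw [show (c : ℂ) * (τ + 1) + d = c * τ + (c + d) by ring]
  congr 5
  ring

lemma EisJSummand_neg_inv (k m : ℕ) {τ : ℂ} (hτ : 0 < τ.im) (z : ℂ) {c d : ℤ}
    (h : IsCoprime c d) : EisJSummand k m (-1 / τ) (z / τ) c d =
      τ ^ k * e2 (m * (z ^ 2 / τ)) * EisJSummand k m τ z d (-c) := by
  have hb := bezout_spec h
  have h0 := isCoprime_denom_ne_zero h.symm.neg_right hτ
  have hτ0 := ne_zero_of_im_pos hτ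
  rw [EisJSummand_bezout, EisJSummand_eq k m hτ z (a := (bezout c d).2)
    (b := -(bezout c d).1) (by linarith)]
  push_cast at h0 ⊢
  have hw : (c : ℂ) * (-1 / τ) + d = (d * τ + -c) / τ := by field_simp; ring
  rw [hw, div_zpow, zpow_neg τ, zpow_natCast, div_inv_eq_mul]
  have h1 : z / τ / ((d * τ + -c) / τ) = z / (d * τ + -c) := by field_simp
  have h2 : (((bezout c d).1 : ℂ) * (-1 / τ) + (bezout c d).2) / ((d * τ + -c) / τ) =
    ((bezout c d).2 * τ + -(bezout c d).1) / (d * τ + -c) := by field_simp; ring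
  have h3 : e2 (-(m * (c * (z / τ) ^ 2 / ((d * τ + -c) / τ)))) =
      e2 (m * (z ^ 2 / τ)) * e2 (-(m * (d * z ^ 2 / (d * τ + -c)))) := by
    rw [e2, e2, e2, ← Complex.exp_add]
    congr 1
    have h4 : (z ^ 2 / τ) = (z ^ 2 * (d * τ + -c)) / (τ * (d * τ + -c)) :=
      (mul_div_mul_right _ _ h0).symm
    rw [h4]
    field_simp
    ring
  rw [h1, h2, h3]
  ring

/-- The index set of the Jacobi–Eisenstein series. -/
abbrev CoprimePair := {p : ℤ × ℤ // IsCoprime p.1 p.2}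

/-- The action `(c, d) ↦ (c, c + d)` on coprime pairs. -/
def coprimeT : CoprimePair ≃ CoprimePair where
  toFun p := ⟨(p.1.1, p.1.1 + p.1.2), by
    have := p.2.add_mul_left_right 1
    simpa [add_comm] using this⟩
  invFun p := ⟨(p.1.1, -p.1.1 + p.1.2), by
    have := p.2.add_mul_left_right (-1)
    simpa [add_comm] using this⟩
  left_inv p := by ext <;> simp
  right_inv p := by ext <;> simp

/-- The action `(c, d) ↦ (d, -c)` on coprime pairs. -/
def coprimeS : CoprimePair ≃ CoprimePair where
  toFun p := ⟨(p.1.2, -p.1.1), p.2.symm.neg_right⟩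
  invFun p := ⟨(-p.1.2, p.1.1), p.2.symm.neg_left⟩
  left_inv p := by ext <;> simp
  right_inv p := by ext <;> simp

lemma EisJ_add_one (k m : ℕ) {τ : ℂ} (hτ : 0 < τ.im) (z : ℂ) :
    EisJ k m (τ + 1) z = EisJ k m τ z := by
  rw [EisJ, EisJ, ← coprimeT.tsum_eq fun p => EisJSummand k m τ z p.1.1 p.1.2]
  congr 1
  exact tsum_congr fun p => EisJSummand_add_one k m hτ z p.2

lemma EisJ_neg_inv (k m : ℕ) {τ : ℂ} (hτ : 0 < τ.im) (z : ℂ) :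
    EisJ k m (-1 / τ) (z / τ) = τ ^ k * e2 (m * (z ^ 2 / τ)) * EisJ k m τ z := by
  rw [EisJ, EisJ, ← coprimeS.tsum_eq fun p => EisJSummand k m τ z p.1.1 p.1.2,
    tsum_congr fun p : CoprimePair => EisJSummand_neg_inv k m hτ z p.2, tsum_mul_left,
    mul_left_comm]
  rfl

/-- If a property of coprime pairs holds for `(0, 1)` and is preserved by
`(c, d) ↦ (c, c + d)`, `(c, d) ↦ (c, d - c)` and `(c, d) ↦ (d, -c)`, it always holds. -/
lemma coprime_induction {P : ℤ → ℤ → Prop} (h01 : P 0 1)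
    (hT : ∀ c d, IsCoprime c d → P c d → P c (c + d))
    (hT' : ∀ c d, IsCoprime c d → P c d → P c (-c + d))
    (hS : ∀ c d, IsCoprime c d → P c d → P d (-c)) :
    ∀ c d, IsCoprime c d → P c d := by
  have hTn : ∀ (q c d : ℤ), IsCoprime c d → P c d → P c (d + c * q) := by
    intro q
    induction q with
    | zero => intro c d _ h; simpa using h
    | succ n ih =>
      intro c d hc h
      have := hT c _ (hc.add_mul_left_right n) (ih c d hc h)
      convert this using 1; ring
    | pred n ih =>
      intro c d hc h
      have := hT' c _ (hc.add_mul_left_right (-n)) (ih c d hc h)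
      convert this using 1; ring
  intro c
  induction hn : c.natAbs using Nat.strong_induction_on generalizing c with
  | _ n ih =>
    intro d hcd
    by_cases hc : c = 0
    · subst hc
      rw [isCoprime_zero_left, Int.isUnit_iff] at hcd
      rcases hcd with rfl | rfl
      · exact h01
      · have h1 := hS 0 1 isCoprime_one_right h01
        simpa using hS _ _ isCoprime_one_left h1
    · have hr : IsCoprime c (d % c) := by
        have := hcd.add_mul_left_right (-(d / c))
        rwa [show d + c * -(d / c) = d % c by rw [Int.emod_def]; ring] at this
      have h1 := ih (-(d % c)).natAbs (by
        rw [← hn, Int.natAbs_neg]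
        have h2 := Int.emod_lt_abs d hc
        have h3 := Int.emod_nonneg d hc
        rw [Int.abs_eq_natAbs] at h2
        omega) (-(d % c)) rfl c hr.symm.neg_left
      have h2 := hS _ _ hr.symm.neg_left h1
      rw [neg_neg] at h2
      have h3 := hTn (d / c) c _ hr h2
      rwa [Int.emod_add_mul_ediv] at h3

lemma sub_one_im {τ : ℂ} (hτ : 0 < τ.im) : 0 < (τ - 1).im := by simpa using hτ

lemma EisJSummand_mem_span (k m : ℕ) {X Y Z : ℂ → ℂ → ℂ}
    (hXT : ∀ τ z, X (τ + 1) z = X τ z) (hYT : ∀ τ z, Y (τ + 1) z = Z τ z)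
    (hZT : ∀ τ z, Z (τ + 1) z = Y τ z)
    (hXS : ∀ τ z, 0 < τ.im → X (-1 / τ) (z / τ) = e2 (m * (z ^ 2 / τ)) * Y τ z)
    (hYS : ∀ τ z, 0 < τ.im → Y (-1 / τ) (z / τ) = e2 (m * (z ^ 2 / τ)) * X τ z)
    (hZS : ∀ τ z, 0 < τ.im → Z (-1 / τ) (z / τ) = e2 (m * (z ^ 2 / τ)) * Z τ z)
    (h01 : ∀ τ, 0 < τ.im → ∃ x y w : ℂ, ∀ z,
      EisJSummand k m τ z 0 1 = x * X τ z + y * Y τ z + w * Z τ z) :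
    ∀ c d, IsCoprime c d → ∀ τ, 0 < τ.im → ∃ x y w : ℂ, ∀ z,
      EisJSummand k m τ z c d = x * X τ z + y * Y τ z + w * Z τ z := by
  refine coprime_induction h01 ?_ ?_ ?_
  · intro c d h ih τ hτ
    obtain ⟨x, y, w, H⟩ := ih (τ + 1) (by simpa using hτ)
    refine ⟨x, w, y, fun z => ?_⟩
    rw [← EisJSummand_add_one k m hτ z h, H, hXT, hYT, hZT]
    ring
  · intro c d h ih τ hτ
    obtain ⟨x, y, w, H⟩ := ih (τ - 1) (sub_one_im hτ)
    refine ⟨x, w, y, fun z => ?_⟩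
    have h' : IsCoprime c (-c + d) := (coprimeT.symm ⟨(c, d), h⟩).2
    have h1 := EisJSummand_add_one k m (sub_one_im hτ) z h'
    rw [sub_add_cancel, add_neg_cancel_left] at h1
    have h2 := hXT (τ - 1) z
    have h3 := hYT (τ - 1) z
    have h4 := hZT (τ - 1) z
    rw [sub_add_cancel] at h2 h3 h4
    rw [h1, H, h2, h3, h4]
    ring
  · intro c d h ih τ hτ
    obtain ⟨x, y, w, H⟩ := ih (-1 / τ) (neg_one_div_im_pos hτ)
    refine ⟨y / τ ^ k, x / τ ^ k, w / τ ^ k, fun z => ?_⟩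
    have h1 := EisJSummand_neg_inv k m hτ z h
    rw [H, hXS τ z hτ, hYS τ z hτ, hZS τ z hτ] at h1
    have h2 := ne_zero_of_im_pos hτ
    have h3 : e2 (m * (z ^ 2 / τ)) ≠ 0 := Complex.exp_ne_zero _
    have h4 : x * Y τ z + y * X τ z + w * Z τ z = τ ^ k * EisJSummand k m τ z d (-c) :=
      mul_left_cancel₀ h3 (by linear_combination h1)
    field_simp
    linear_combination -h4

lemma exp_neg_le_rpow {x : ℝ} (hx : 0 < x) : Real.exp (-x) ≤ x ^ (-(3 / 4) : ℝ) := by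
  rw [Real.rpow_def_of_pos hx, Real.exp_le_exp]
  have := Real.log_le_sub_one_of_pos hx
  rcases le_total 0 (Real.log x) with h | h <;> linarith

/-- The constant in the estimate `Σ_l e^{-t(l+s)²} ≤ 1 + K t^{-3/4}`. -/
def gaussConst : ℝ := ∑' l : ℤ, (4 : ℝ) ^ (3 / 4 : ℝ) * |(l : ℝ)| ^ (-(3 / 2) : ℝ)

lemma gaussConst_nonneg : 0 ≤ gaussConst := tsum_nonneg fun l => by positivity

lemma gauss_term_le {t s : ℝ} (ht : 0 < t) (hs : |s| ≤ 1 / 2) (l : ℤ) :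
    Real.exp (-t * (l + s) ^ 2) ≤ (if l = 0 then 1 else 0) +
      t ^ (-(3 / 4) : ℝ) * ((4 : ℝ) ^ (3 / 4 : ℝ) * |(l : ℝ)| ^ (-(3 / 2) : ℝ)) := by
  split_ifs with h
  · have h1 : Real.exp (-t * (l + s) ^ 2) ≤ 1 := by
      rw [Real.exp_le_one_iff]
      nlinarith [sq_nonneg (l + s)]
    have h2 : 0 ≤ t ^ (-(3 / 4) : ℝ) * ((4 : ℝ) ^ (3 / 4 : ℝ) * |(l : ℝ)| ^ (-(3 / 2) : ℝ)) := by
      positivity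
    linarith
  · have h1 : (1 : ℝ) ≤ |(l : ℝ)| := by exact_mod_cast Int.one_le_abs h
    have hl : 0 < |(l : ℝ)| := by linarith
    have h2 : |(l : ℝ)| / 2 ≤ |l + s| := by
      have := abs_sub_abs_le_abs_sub (l : ℝ) (-s)
      rw [abs_neg, sub_neg_eq_add] at this
      linarith
    have h3 : (|(l : ℝ)| / 2) ^ 2 ≤ (l + s) ^ 2 := by
      rw [← sq_abs ((l : ℝ) + s)]
      gcongr
    have h4 : 0 < t * (|(l : ℝ)| / 2) ^ 2 := by positivity
    calc Real.exp (-t * (l + s) ^ 2) ≤ Real.exp (-(t * (|(l : ℝ)| / 2) ^ 2)) := by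
          rw [Real.exp_le_exp]; nlinarith
      _ ≤ (t * (|(l : ℝ)| / 2) ^ 2) ^ (-(3 / 4) : ℝ) := exp_neg_le_rpow h4
      _ = _ := by
          rw [Real.mul_rpow ht.le (by positivity), div_pow, Real.div_rpow (by positivity)
            (by positivity), ← Real.rpow_natCast, ← Real.rpow_mul hl.le, zero_add]
          norm_num [Real.rpow_neg]
          left; ring

lemma gauss_sum_le {t : ℝ} (ht : 0 < t) (s : ℝ) :
    Summable (fun l : ℤ => Real.exp (-t * (l + s) ^ 2)) ∧
    ∑' l : ℤ, Real.exp (-t * (l + s) ^ 2) ≤ 1 + gaussConst * t ^ (-(3 / 4) : ℝ) := by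
  have hs : |s - round s| ≤ 1 / 2 := abs_sub_round s
  have hsum : Summable fun l : ℤ => (4 : ℝ) ^ (3 / 4 : ℝ) * |(l : ℝ)| ^ (-(3 / 2) : ℝ) :=
    (Real.summable_abs_int_rpow (by norm_num)).mul_left _
  have h0 : HasSum (fun l : ℤ => if l = 0 then (1 : ℝ) else 0) 1 := hasSum_ite_eq 0 1
  have h1 := h0.add (hsum.hasSum.mul_left (t ^ (-(3 / 4) : ℝ)))
  have h2 : Summable fun l : ℤ => Real.exp (-t * (l + (s - round s)) ^ 2) :=
    Summable.of_nonneg_of_le (fun _ => (Real.exp_pos _).le) (gauss_term_le ht hs) h1.summable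
  have h3 : ∀ l : ℤ, Real.exp (-t * (l + s) ^ 2) =
      Real.exp (-t * ((Equiv.addRight (round s) l : ℤ) + (s - round s)) ^ 2) := by
    intro l
    simp only [Equiv.coe_addRight, Int.cast_add]
    congr 2; ring
  simp only [h3]
  refine ⟨(Equiv.addRight (round s)).summable_iff.2 h2, ?_⟩
  rw [(Equiv.addRight (round s)).tsum_eq fun l : ℤ => Real.exp (-t * (l + (s - round s)) ^ 2),
    mul_comm gaussConst]
  exact h1.tsum_eq ▸ h2.tsum_le_tsum (gauss_term_le ht hs) h1.summable

/-- The summands of the theta decomposition `e^{2πimλ²τ} E_{4,m}(τ, λτ+μ)`. -/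
def jacTerm (m : ℕ) (lam mu : ℝ) (c d : ℤ) (τ : ℂ) : ℂ :=
  e2 (m * lam ^ 2 * τ) * EisJSummand 4 m τ (lam * τ + mu) c d

lemma moebius_im {a b c d : ℤ} (h : a * d - b * c = 1) (τ : ℂ) :
    (((a : ℂ) * τ + b) / (c * τ + d)).im = τ.im / ‖(c : ℂ) * τ + d‖ ^ 2 := by
  have h' : (a : ℝ) * d - b * c = 1 := by exact_mod_cast h
  rw [Complex.div_im, ← Complex.normSq_eq_norm_sq, ← sub_div]
  congr 1
  simp only [add_im, mul_im, intCast_re, intCast_im, zero_mul, add_zero, add_re, mul_re, sub_zero]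
  linear_combination τ.im * h'

lemma jacTerm_exponent {a b c d : ℤ} (h : a * d - b * c = 1) (m : ℕ) (lam mu l τ : ℂ)
    (hw : (c : ℂ) * τ + d ≠ 0) :
    m * lam ^ 2 * τ + (-(m * (c * (lam * τ + mu) ^ 2 / (c * τ + d))) +
      (l * (2 * m * ((lam * τ + mu) / (c * τ + d))) +
        l ^ 2 * (m * ((a * τ + b) / (c * τ + d))))) =
    m * ((l + (d * lam - c * mu)) ^ 2 * ((a * τ + b) / (c * τ + d)) +
      2 * l * (a * mu - b * lam) + (d * lam - c * mu) * (a * mu - b * lam) - lam * mu) := by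
  have h' : (a : ℂ) * d - b * c = 1 := by exact_mod_cast h
  set u := d * lam - c * mu with hu
  set v := a * mu - b * lam with hv
  have hz : (lam * τ + mu) / (c * τ + d) = u * ((a * τ + b) / (c * τ + d)) + v := by
    rw [div_eq_iff hw, add_mul, mul_assoc, div_mul_cancel₀ _ hw, hu, hv]
    linear_combination (-lam * τ - mu) * h'
  have h1 : lam * (c * τ + d) - c * (lam * τ + mu) = u := by rw [hu]; ring
  have h2 : lam ^ 2 * τ - c * (lam * τ + mu) ^ 2 / (c * τ + d) =
      u * ((lam * τ + mu) / (c * τ + d)) - lam * mu := by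
    rw [← h1, ← mul_div_assoc, eq_sub_iff_add_eq, sub_add_eq_add_sub, sub_eq_iff_eq_add,
      ← add_div, eq_div_iff hw]
    ring
  rw [hz] at h2
  rw [hz]
  linear_combination m * h2

lemma norm_e2_ofReal_mul_add (x : ℝ) (g : ℂ) (y : ℝ) :
    ‖e2 (x * g + y)‖ = Real.exp (-(2 * Real.pi * x) * g.im) := by
  rw [e2, Complex.norm_exp]
  congr 1
  simp
  ring

lemma norm_jacTerm_le {m : ℕ} (hm : 1 ≤ m) (lam mu : ℝ) {c d : ℤ} (h : IsCoprime c d) {τ : ℂ}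
    (hτ : 0 < τ.im) : ‖jacTerm m lam mu c d τ‖ ≤ ‖(c : ℂ) * τ + d‖ ^ (-4 : ℝ) +
      gaussConst * τ.im ^ (-(3 / 4) : ℝ) * ‖(c : ℂ) * τ + d‖ ^ (-(5 / 2) : ℝ) := by
  have hb := bezout_spec h
  have hw := isCoprime_denom_ne_zero h hτ
  set a := (bezout c d).1
  set b := (bezout c d).2
  have hn : 0 < ‖(c : ℂ) * τ + d‖ := norm_pos_iff.2 hw
  set n := ‖(c : ℂ) * τ + d‖ with hn'
  set t : ℝ := 2 * Real.pi * m * (τ.im / n ^ 2) with ht'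
  have hm' : (1 : ℝ) ≤ m := by exact_mod_cast hm
  have ht : 0 < t := by have := Real.pi_pos; positivity
  set s : ℝ := d * lam - c * mu with hs
  have hterm : ∀ l : ℤ, ‖e2 (m * lam ^ 2 * τ) * (e2 (-(m * (c * (lam * τ + mu) ^ 2 / (c * τ + d))))
      * jacobiTheta₂_term l (2 * m * ((lam * τ + mu) / (c * τ + d)))
        (2 * m * ((a * τ + b) / (c * τ + d))))‖ = Real.exp (-t * (l + s) ^ 2) := by
    intro l
    have h1 : jacobiTheta₂_term l (2 * m * ((lam * τ + mu) / (c * τ + d)))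
        (2 * m * ((a * τ + b) / (c * τ + d))) = e2 (l * (2 * m * ((lam * τ + mu) / (c * τ + d))) +
        (l : ℂ) ^ 2 * (m * ((a * τ + b) / (c * τ + d)))) := by
      rw [e2, jacobiTheta₂_term]
      congr 1; ring
    have hadd : ∀ x y : ℂ, e2 x * e2 y = e2 (x + y) := fun x y => by
      rw [e2, e2, e2, ← Complex.exp_add]; congr 1; ring
    rw [h1, hadd, hadd, jacTerm_exponent hb m lam mu l τ hw]
    have h2 := norm_e2_ofReal_mul_add (m * (l + s) ^ 2) ((a * τ + b) / (c * τ + d))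
      (m * (2 * l * (a * mu - b * lam) + s * (a * mu - b * lam) - lam * mu))
    rw [moebius_im hb] at h2
    push_cast [hs] at h2
    rw [show (m : ℂ) * ((l + (d * lam - c * mu)) ^ 2 * ((a * τ + b) / (c * τ + d)) +
      2 * l * (a * mu - b * lam) + (d * lam - c * mu) * (a * mu - b * lam) - lam * mu) =
      m * (l + (d * lam - c * mu)) ^ 2 * ((a * τ + b) / (c * τ + d)) + m * (
      2 * l * (a * mu - b * lam) + (d * lam - c * mu) * (a * mu - b * lam) - lam * mu) by ring, h2]
    congr 1
    rw [ht', hn', hs]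
    ring
  obtain ⟨g1, g2⟩ := gauss_sum_le ht s
  have hmain : ‖e2 (m * lam ^ 2 * τ) * (e2 (-(m * (c * (lam * τ + mu) ^ 2 / (c * τ + d)))) *
      jacobiTheta₂ (2 * m * ((lam * τ + mu) / (c * τ + d)))
        (2 * m * ((a * τ + b) / (c * τ + d))))‖ ≤ 1 + gaussConst * t ^ (-(3 / 4) : ℝ) := by
    refine le_trans ?_ g2
    rw [jacobiTheta₂, ← tsum_mul_left, ← tsum_mul_left]
    simp only [← hterm] at g1 ⊢
    exact norm_tsum_le_tsum_norm g1
  have h5 : t ^ (-(3 / 4) : ℝ) ≤ τ.im ^ (-(3 / 4) : ℝ) * n ^ (3 / 2 : ℝ) := by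
    have h6 : τ.im / n ^ 2 ≤ t := by
      rw [ht']
      have : 1 ≤ 2 * Real.pi * m := by nlinarith [Real.pi_gt_three]
      exact le_mul_of_one_le_left (by positivity) this
    refine (Real.rpow_le_rpow_of_nonpos (by positivity) h6 (by norm_num)).trans_eq ?_
    rw [Real.div_rpow hτ.le (by positivity), ← Real.rpow_natCast n 2, ← Real.rpow_mul hn.le,
      div_eq_mul_inv, ← Real.rpow_neg hn.le]
    norm_num
  rw [jacTerm, EisJSummand_bezout, mul_left_comm, norm_mul, norm_zpow, ← hn']
  have h7 : n ^ (-((4 : ℕ) : ℤ)) = n ^ (-4 : ℝ) := by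
    rw [← Real.rpow_intCast]; norm_num
  rw [h7]
  calc _ ≤ n ^ (-4 : ℝ) * (1 + gaussConst * (τ.im ^ (-(3 / 4) : ℝ) * n ^ (3 / 2 : ℝ))) := by
        gcongr
        refine hmain.trans ?_
        gcongr
        exact gaussConst_nonneg
    _ = _ := by
        have h8 : n ^ (-4 : ℝ) * n ^ (3 / 2 : ℝ) = n ^ (-(5 / 2) : ℝ) := by
          rw [← Real.rpow_add hn]; norm_num
        rw [← h8]; ring

lemma jacTerm_dominated {m : ℕ} (hm : 1 ≤ m) (lam mu : ℝ) (A : ℝ) {B : ℝ} (hB : 0 < B) :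
    ∃ u : CoprimePair → ℝ, Summable u ∧ ∀ p : CoprimePair, ∀ τ : ℂ, |τ.re| ≤ A → B ≤ τ.im →
      ‖jacTerm m lam mu p.1.1 p.1.2 τ‖ ≤ u p := by
  set R := EisensteinSeries.r ⟨⟨A, B⟩, hB⟩ with hR
  let vec : CoprimePair → Fin 2 → ℤ := fun p => ![p.1.1, p.1.2]
  have hvec : Function.Injective vec := by
    intro p q h
    have h0 := congrFun h 0
    have h1 := congrFun h 1
    ext
    · simpa [vec] using h0
    · simpa [vec] using h1
  have hs4 := ((EisensteinSeries.summable_one_div_norm_rpow (k := 4) (by norm_num)).comp_injective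
    hvec).mul_left (R ^ (-4 : ℝ))
  have hs5 := ((EisensteinSeries.summable_one_div_norm_rpow (k := 5 / 2)
    (by norm_num)).comp_injective hvec).mul_left
      (gaussConst * B ^ (-(3 / 4) : ℝ) * R ^ (-(5 / 2) : ℝ))
  refine ⟨_, hs4.add hs5, fun p τ h1 h2 => ?_⟩
  have hτ : 0 < τ.im := hB.trans_le h2
  have hmem : (⟨τ, hτ⟩ : UpperHalfPlane) ∈ UpperHalfPlane.verticalStrip A B := ⟨h1, h2⟩
  have b4 := EisensteinSeries.summand_bound_of_mem_verticalStrip (k := 4) (by norm_num) (vec p) hB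
    hmem
  have b5 := EisensteinSeries.summand_bound_of_mem_verticalStrip (k := 5 / 2) (by norm_num) (vec p)
    hB hmem
  rw [← hR] at b4 b5
  simp only [vec, Matrix.cons_val_zero, Matrix.cons_val_one] at b4 b5
  refine (norm_jacTerm_le hm lam mu p.2 hτ).trans ?_
  have h3 : τ.im ^ (-(3 / 4) : ℝ) ≤ B ^ (-(3 / 4) : ℝ) :=
    Real.rpow_le_rpow_of_nonpos hB h2 (by norm_num)
  have h4 := mul_le_mul (mul_le_mul_of_nonneg_left h3 gaussConst_nonneg) b5 (by positivity)
    (mul_nonneg gaussConst_nonneg (by positivity))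
  simp only [Function.comp_apply, vec]
  refine add_le_add b4 (h4.trans_eq ?_)
  ring

lemma summable_jacTerm {m : ℕ} (hm : 1 ≤ m) (lam mu : ℝ) {τ : ℂ} (hτ : 0 < τ.im) :
    Summable fun p : CoprimePair => jacTerm m lam mu p.1.1 p.1.2 τ := by
  obtain ⟨u, hu, h⟩ := jacTerm_dominated hm lam mu |τ.re| hτ
  exact Summable.of_norm_bounded hu fun p => h p τ le_rfl le_rfl

lemma exists_real_coordinates {τ : ℂ} (hτ : 0 < τ.im) (z : ℂ) :
    ∃ lam mu : ℝ, z = lam * τ + mu := by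
  refine ⟨z.im / τ.im, z.re - z.im / τ.im * τ.re, ?_⟩
  apply Complex.ext
  · simp
  · simp [hτ.ne']

lemma summable_EisJSummand {m : ℕ} (hm : 1 ≤ m) {τ : ℂ} (hτ : 0 < τ.im) (z : ℂ) :
    Summable fun p : CoprimePair => EisJSummand 4 m τ z p.1.1 p.1.2 := by
  obtain ⟨lam, mu, rfl⟩ := exists_real_coordinates hτ z
  have h : e2 (m * lam ^ 2 * τ) ≠ 0 := Complex.exp_ne_zero _
  exact (summable_mul_left_iff h).1 (summable_jacTerm hm lam mu hτ)

/-- `e^{2πimλ²τ} E_{4,m}(τ, λτ+μ)`. -/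
def EisJTorsion (m : ℕ) (lam mu : ℝ) (τ : ℂ) : ℂ :=
  e2 (m * lam ^ 2 * τ) * EisJ 4 m τ (lam * τ + mu)

lemma EisJTorsion_eq_tsum (m : ℕ) (lam mu : ℝ) (τ : ℂ) : EisJTorsion m lam mu τ =
    1 / 2 * ∑' p : CoprimePair, jacTerm m lam mu p.1.1 p.1.2 τ := by
  rw [EisJTorsion, EisJ, mul_left_comm, ← tsum_mul_left]
  rfl

lemma differentiableAt_jacTerm (m : ℕ) (lam mu : ℝ) {c d : ℤ} (h : IsCoprime c d) (hm : 1 ≤ m)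
    {τ : ℂ} (hτ : 0 < τ.im) : DifferentiableAt ℂ (jacTerm m lam mu c d) τ := by
  have hw := isCoprime_denom_ne_zero h hτ
  unfold jacTerm
  simp only [EisJSummand_bezout, e2]
  have h1 : DifferentiableAt ℂ (fun τ : ℂ => ((c : ℂ) * τ + d) ^ (-((4 : ℕ) : ℤ))) τ :=
    DifferentiableAt.zpow (by fun_prop) (Or.inl hw)
  have him : 0 < (2 * (m : ℂ) * (((bezout c d).1 * τ + (bezout c d).2) / (c * τ + d))).im := by
    have hm' : (0 : ℝ) < m := by exact_mod_cast hm
    have := norm_pos_iff.2 hw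
    rw [show (2 * (m : ℂ)) = ((2 * m : ℝ) : ℂ) by push_cast; rfl, Complex.im_ofReal_mul,
      moebius_im (bezout_spec h)]
    positivity
  have h2 := (hasFDerivAt_jacobiTheta₂ (2 * m * ((lam * τ + mu) / (c * τ + d)))
    him).differentiableAt
  have h3 : DifferentiableAt ℂ (fun τ : ℂ => ((2 * m * ((lam * τ + mu) / (c * τ + d)) : ℂ),
      (2 * m * (((bezout c d).1 * τ + (bezout c d).2) / (c * τ + d)) : ℂ))) τ := by
    fun_prop (disch := assumption)
  have h4 := DifferentiableAt.comp τ h2 h3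
  have h5 : DifferentiableAt ℂ
      (fun τ : ℂ => (m : ℂ) * (c * (lam * τ + mu) ^ 2 / (c * τ + d))) τ := by
    fun_prop (disch := assumption)
  have h6 := (((h5.neg).const_mul (2 * (Real.pi : ℂ) * I)).cexp.mul h4)
  have h7 : DifferentiableAt ℂ
      (fun τ : ℂ => cexp (2 * (Real.pi : ℂ) * I * (m * lam ^ 2 * τ))) τ := by
    fun_prop
  exact h7.mul (h1.mul h6)

lemma differentiableAt_EisJTorsion {m : ℕ} (hm : 1 ≤ m) (lam mu : ℝ) {τ : ℂ} (hτ : 0 < τ.im) :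
    DifferentiableAt ℂ (EisJTorsion m lam mu) τ := by
  obtain ⟨u, hu, h⟩ := jacTerm_dominated hm lam mu (|τ.re| + 1) (half_pos hτ)
  have hU : IsOpen ({w : ℂ | |w.re| < |τ.re| + 1} ∩ {w : ℂ | τ.im / 2 < w.im}) :=
    (isOpen_lt (by fun_prop) continuous_const).inter
      (isOpen_lt continuous_const Complex.continuous_im)
  have hd := Complex.differentiableOn_tsum_of_summable_norm hu
    (F := fun (p : CoprimePair) τ => jacTerm m lam mu p.1.1 p.1.2 τ)
    (fun p w hw => (differentiableAt_jacTerm m lam mu p.2 hm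
      ((half_pos hτ).trans hw.2)).differentiableWithinAt) hU
    (fun p w hw => h p w hw.1.le hw.2.le)
  have hmem : τ ∈ ({w : ℂ | |w.re| < |τ.re| + 1} ∩ {w : ℂ | τ.im / 2 < w.im}) :=
    ⟨by simp, by simpa using hτ⟩
  have := ((hd τ hmem).differentiableAt (hU.mem_nhds hmem)).const_mul (1 / 2)
  exact this.congr_of_eventuallyEq (Filter.Eventually.of_forall (EisJTorsion_eq_tsum m lam mu))

lemma tendsto_jacTerm {m : ℕ} (hm : 1 ≤ m) (lam mu : ℝ) {c d : ℤ} (h : IsCoprime c d)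
    (hc : c ≠ 0) : Filter.Tendsto (jacTerm m lam mu c d) stripInfty (nhds 0) := by
  have h1 : ∀ k : ℝ, 0 < k → Filter.Tendsto (fun τ : ℂ => τ.im ^ (-k)) stripInfty (nhds 0) :=
    fun k hk => (tendsto_rpow_neg_atTop hk).comp tendsto_im_stripInfty
  have h2 := (h1 4 (by norm_num)).add (((h1 (3 / 4) (by norm_num)).const_mul gaussConst).mul
    (h1 (5 / 2) (by norm_num)))
  simp only [mul_zero, add_zero] at h2
  refine squeeze_zero_norm' ?_ h2
  filter_upwards [eventually_stripInfty_im 0] with τ hτ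
  refine (norm_jacTerm_le hm lam mu h hτ).trans ?_
  have h3 : τ.im ≤ ‖(c : ℂ) * τ + d‖ := by
    have h4 := Complex.abs_im_le_norm ((c : ℂ) * τ + d)
    simp only [add_im, mul_im, intCast_re, intCast_im, zero_mul, add_zero, abs_mul,
      abs_of_pos hτ] at h4
    have h5 : (1 : ℝ) ≤ |(c : ℝ)| := by exact_mod_cast Int.one_le_abs hc
    nlinarith
  have h6 : ∀ k : ℝ, 0 < k → ‖(c : ℂ) * τ + d‖ ^ (-k) ≤ τ.im ^ (-k) := fun k hk =>
    Real.rpow_le_rpow_of_nonpos hτ h3 (by linarith)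
  have h7 := h6 4 (by norm_num)
  have h8 := h6 (5 / 2) (by norm_num)
  have := gaussConst_nonneg
  gcongr

lemma EisJSummand_zero_one (m : ℕ) {τ : ℂ} (hτ : 0 < τ.im) (z : ℂ) :
    EisJSummand 4 m τ z 0 1 = jacobiTheta₂ (2 * m * z) (2 * m * τ) := by
  rw [EisJSummand_eq 4 m hτ z (a := 1) (b := 0) (by norm_num)]
  simp [e2]

lemma EisJSummand_zero_neg_one (m : ℕ) {τ : ℂ} (hτ : 0 < τ.im) (z : ℂ) :
    EisJSummand 4 m τ z 0 (-1) = jacobiTheta₂ (2 * m * z) (2 * m * τ) := by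
  rw [EisJSummand_eq 4 m hτ z (a := -1) (b := 0) (by norm_num)]
  simp [e2, div_neg, jacobiTheta₂_neg_left, Even.neg_pow (show Even 4 by decide)]

lemma tendsto_EisJTorsion {m : ℕ} (hm : 1 ≤ m) (lam mu : ℝ) {L : ℂ}
    (hL : Filter.Tendsto (fun τ : ℂ => e2 (m * lam ^ 2 * τ) *
      jacobiTheta₂ (2 * m * (lam * τ + mu)) (2 * m * τ)) stripInfty (nhds L)) :
    Filter.Tendsto (EisJTorsion m lam mu) stripInfty (nhds L) := by
  obtain ⟨u, hu, h⟩ := jacTerm_dominated hm lam mu 1 one_pos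
  let p₁ : CoprimePair := ⟨(0, 1), isCoprime_one_right⟩
  let p₂ : CoprimePair := ⟨(0, -1), isCoprime_one_right.neg_right⟩
  have hne : p₁ ≠ p₂ := by
    intro h; have := congrArg (fun p : CoprimePair => p.1.2) h; simp [p₁, p₂] at this
  have hsum : ∑' p : CoprimePair, (if p.1.1 = 0 then L else 0) = 2 * L := by
    rw [tsum_eq_sum (s := {p₁, p₂})]
    · rw [Finset.sum_pair hne]; simp [p₁, p₂]; ring
    · rintro ⟨⟨c, d⟩, hp⟩ hn
      rw [if_neg]
      rintro rfl
      rw [isCoprime_zero_left, Int.isUnit_iff] at hp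
      rcases hp with rfl | rfl <;> simp [p₁, p₂] at hn
  have key := tendsto_tsum_of_dominated_convergence (𝓕 := stripInfty) hu
    (f := fun τ (p : CoprimePair) => jacTerm m lam mu p.1.1 p.1.2 τ)
    (g := fun p : CoprimePair => if p.1.1 = 0 then L else 0) ?_ ?_
  · have := key.const_mul (1 / 2)
    rw [hsum] at this
    simp only [← EisJTorsion_eq_tsum] at this
    convert! this using 2
    ring
  · rintro ⟨⟨c, d⟩, hp⟩
    by_cases hc : c = 0
    · subst hc
      simp only [if_true]
      rw [isCoprime_zero_left, Int.isUnit_iff] at hp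
      refine hL.congr' ?_
      filter_upwards [eventually_stripInfty_im 0] with τ hτ
      rw [jacTerm]
      rcases hp with rfl | rfl
      · rw [EisJSummand_zero_one m hτ]
      · rw [EisJSummand_zero_neg_one m hτ]
    · simp only [if_neg hc]
      exact tendsto_jacTerm hm lam mu hp hc
  · filter_upwards [eventually_stripInfty_im 1, eventually_stripInfty_re] with τ h1 h2 p
    exact h p τ h2 h1.le

section Xi

lemma xi10_add_one_tau (τ z : ℂ) : xi10 (τ + 1) z = xi10 τ z := by
  rw [xi10, xi10, theta10_add_one_tau, theta10_add_one_tau,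
    mul_div_mul_left _ _ (Complex.exp_ne_zero _)]

lemma xi01_add_one_tau (τ z : ℂ) : xi01 (τ + 1) z = xi00 τ z := by
  rw [xi00, xi01, theta01_add_one_tau, theta01_add_one_tau]

lemma xi00_add_one_tau (τ z : ℂ) : xi00 (τ + 1) z = xi01 τ z := by
  rw [xi00, xi01, theta00_add_one_tau, theta00_add_one_tau]

variable {τ : ℂ}

lemma xi10_neg_inv (hτ : 0 < τ.im) (z : ℂ) : xi10 (-1 / τ) (z / τ) =
    cexp ((Real.pi : ℂ) * I * z ^ 2 / τ) * xi01 τ z := by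
  rw [xi10, xi01, theta10_neg_inv hτ, (theta_null_neg_inv hτ).2.2, mul_assoc,
    mul_div_mul_left _ _ (thetaFactor_ne_zero hτ), mul_div_assoc]

lemma xi01_neg_inv (hτ : 0 < τ.im) (z : ℂ) : xi01 (-1 / τ) (z / τ) =
    cexp ((Real.pi : ℂ) * I * z ^ 2 / τ) * xi10 τ z := by
  rw [xi10, xi01, theta01_neg_inv hτ, (theta_null_neg_inv hτ).2.1, mul_assoc,
    mul_div_mul_left _ _ (thetaFactor_ne_zero hτ), mul_div_assoc]

lemma xi00_neg_inv (hτ : 0 < τ.im) (z : ℂ) : xi00 (-1 / τ) (z / τ) =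
    cexp ((Real.pi : ℂ) * I * z ^ 2 / τ) * xi00 τ z := by
  rw [xi00, xi00, theta00_neg_inv hτ, (theta_null_neg_inv hτ).1, mul_assoc,
    mul_div_mul_left _ _ (thetaFactor_ne_zero hτ), mul_div_assoc]

end Xi

section DoublingAndLinearity

variable {τ : ℂ}

lemma theta00_sq_null (hτ : 0 < τ.im) :
    theta00 τ 0 ^ 2 = theta00 (2 * τ) 0 ^ 2 + theta10 (2 * τ) 0 ^ 2 := by
  have := theta00_sq hτ 0
  rw [mul_zero] at this
  rw [this]; ring

lemma theta01_sq_null (hτ : 0 < τ.im) :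
    theta01 τ 0 ^ 2 = theta00 (2 * τ) 0 ^ 2 - theta10 (2 * τ) 0 ^ 2 := by
  have := theta01_sq hτ 0
  rw [mul_zero] at this
  rw [this]; ring

lemma theta10_sq_null (hτ : 0 < τ.im) :
    theta10 τ 0 ^ 2 = 2 * theta00 (2 * τ) 0 * theta10 (2 * τ) 0 := by
  have := theta10_sq hτ 0
  rw [mul_zero] at this
  rw [this]; ring

lemma two_mul_im_pos (hτ : 0 < τ.im) : 0 < (2 * τ).im := by simpa using hτ

lemma theta00_add_theta01 (hτ : 0 < τ.im) (z : ℂ) :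
    theta00 τ z + theta01 τ z = 2 * theta00 (4 * τ) (2 * z) := by
  have h0 := hasSum_theta00 hτ z
  have h1 := hasSum_theta00 hτ (z + 1 / 2)
  rw [← theta01_eq] at h1
  have h4 : 0 < (4 * τ).im := by simpa using hτ
  have h2 := (hasSum_theta00 h4 (2 * z)).mul_left 2
  have h3 := h0.add h1
  have hinj : Function.Injective fun n : ℤ => 2 * n := fun a b h => by simpa using h
  have hexp : ∀ n : ℤ, cexp ((Real.pi : ℂ) * I * (n : ℂ) ^ 2 * τ +
      2 * (Real.pi : ℂ) * I * (n : ℂ) * (z + 1 / 2)) = (-1) ^ n * cexp ((Real.pi : ℂ) * I *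
      (n : ℂ) ^ 2 * τ + 2 * (Real.pi : ℂ) * I * (n : ℂ) * z) := fun n => by
    rw [← Complex.exp_pi_mul_I, ← Complex.exp_int_mul, ← Complex.exp_add]
    congr 1; ring
  simp only [hexp] at h3
  refine (((hinj.hasSum_iff ?_).2 h3).unique (hasSum_of_eq h2 fun n => ?_))
  · intro n hn
    have hodd : Odd n := by
      rw [← Int.not_even_iff_odd]
      rintro ⟨k, rfl⟩
      exact hn ⟨k, by simp only; ring⟩
    rw [hodd.neg_one_zpow]; ring
  · simp only [Function.comp_apply]
    rw [(even_two_mul n).neg_one_zpow, one_mul, ← two_mul]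
    congr 2
    push_cast; ring

lemma jacobiTheta₂_add_nat (z τ : ℂ) (n : ℕ) : jacobiTheta₂ (z + n) τ = jacobiTheta₂ z τ := by
  induction n with
  | zero => simp
  | succ n ih => rw [Nat.cast_succ, ← add_assoc, jacobiTheta₂_add_left, ih]

lemma tendsto_const_mul_im {r : ℕ} (hr : 0 < r) : Filter.Tendsto (fun τ : ℂ => (r : ℂ) * τ)
    stripInfty (Filter.comap Complex.im Filter.atTop) := by
  refine Filter.tendsto_comap_iff.2 ?_
  have hr' : (0 : ℝ) < r := by exact_mod_cast hr
  simpa [Function.comp_def] using tendsto_im_stripInfty.const_mul_atTop hr'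

lemma EisJ_torsion_real (m : ℕ) (mu : ℝ) : EisJTorsion m 0 mu = fun τ => EisJ 4 m τ mu := by
  ext τ
  simp [EisJTorsion, e2]

lemma tendsto_EisJTorsion_real {m : ℕ} (hm : 1 ≤ m) {mu : ℝ} {n : ℕ} (hn : 2 * m * mu = n) :
    Filter.Tendsto (EisJTorsion m 0 mu) stripInfty (nhds 1) := by
  refine tendsto_EisJTorsion hm 0 mu ?_
  refine (tendsto_theta00_null_comap.comp (tendsto_const_mul_im (r := 2 * m) (by omega))).congr
    fun τ => ?_
  have hn' : (2 * m * mu : ℂ) = n := by exact_mod_cast congrArg (fun x : ℝ => (x : ℂ)) hn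
  simp only [Function.comp_apply, theta00_eq, ofReal_zero, zero_mul, zero_add, hn', e2]
  have := jacobiTheta₂_add_nat 0 (2 * m * τ) n
  rw [zero_add] at this
  rw [this]
  simp

lemma EisJ_zero {m : ℕ} (hm : 1 ≤ m) (hτ : 0 < τ.im) : EisJ 4 m τ 0 = Eis 4 τ := by
  have h4 : Even 4 := by decide
  have he : EisJTorsion m 0 0 = fun τ => EisJ 4 m τ 0 := by
    rw [EisJ_torsion_real]; simp
  refine sub_eq_zero.1 (levelOne_eq_zero (k := 4) (by norm_num)
    (F := fun τ => EisJ 4 m τ 0 - Eis 4 τ) ?_ ?_ ?_ ?_ τ hτ)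
  · intro τ hτ
    have h1 := differentiableAt_EisJTorsion hm 0 0 hτ
    rw [he] at h1
    exact h1.sub (differentiableAt_Eis (by norm_num) h4 hτ)
  · intro τ hτ
    simp only [EisJ_add_one 4 m hτ, Eis_add_one]
  · intro τ hτ
    have h1 := EisJ_neg_inv 4 m hτ 0
    simp only [zero_div, ne_eq, OfNat.ofNat_ne_zero, not_false_eq_true, zero_pow, mul_zero, e2,
      Complex.exp_zero, mul_one] at h1
    simp only [h1, Eis_neg_inv (k := 4) (by norm_num) h4 hτ]
    ring
  · have h1 := tendsto_EisJTorsion_real hm (mu := 0) (n := 0) (by simp)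
    rw [he] at h1
    simpa using h1.sub (tendsto_Eis (k := 4) (by norm_num) h4)

lemma EisJ_linear {m : ℕ} (hm : 1 ≤ m) (hτ : 0 < τ.im) {z z₀ z₁ : ℂ} (x y : ℂ)
    (H : ∀ c d, IsCoprime c d → EisJSummand 4 m τ z c d =
      x * EisJSummand 4 m τ z₀ c d + y * EisJSummand 4 m τ z₁ c d) :
    EisJ 4 m τ z = x * EisJ 4 m τ z₀ + y * EisJ 4 m τ z₁ := by
  have h0 := summable_EisJSummand hm hτ z₀
  have h1 := summable_EisJSummand hm hτ z₁
  rw [EisJ, tsum_congr fun p : CoprimePair => H _ _ p.2, (h0.mul_left x).tsum_add (h1.mul_left y),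
    tsum_mul_left, tsum_mul_left, EisJ, EisJ]
  ring

lemma EisJ_linear₃ {m : ℕ} (hm : 1 ≤ m) (hτ : 0 < τ.im) {z z₀ z₁ z₂ : ℂ} (x y w : ℂ)
    (H : ∀ c d, IsCoprime c d → EisJSummand 4 m τ z c d = x * EisJSummand 4 m τ z₀ c d +
      y * EisJSummand 4 m τ z₁ c d + w * EisJSummand 4 m τ z₂ c d) :
    EisJ 4 m τ z = x * EisJ 4 m τ z₀ + y * EisJ 4 m τ z₁ + w * EisJ 4 m τ z₂ := by
  have h0 := summable_EisJSummand hm hτ z₀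
  have h1 := summable_EisJSummand hm hτ z₁
  have h2 := summable_EisJSummand hm hτ z₂
  rw [EisJ, tsum_congr fun p : CoprimePair => H _ _ p.2,
    ((h0.mul_left x).add (h1.mul_left y)).tsum_add (h2.mul_left w),
    (h0.mul_left x).tsum_add (h1.mul_left y),
    tsum_mul_left, tsum_mul_left, tsum_mul_left, EisJ, EisJ, EisJ]
  ring

end DoublingAndLinearity

section IndexOne

variable {τ : ℂ}

lemma theta_double_null_ne_zero (hτ : 0 < τ.im) :
    theta00 (2 * τ) 0 ≠ 0 ∧ theta10 (2 * τ) 0 ≠ 0 := by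
  obtain ⟨h0, -, h2⟩ := theta_null_ne_zero (two_mul_im_pos hτ)
  exact ⟨h0, h2⟩

lemma EisJSummand_one_mem_span (hτ : 0 < τ.im) {c d : ℤ} (h : IsCoprime c d) :
    ∃ x y : ℂ, ∀ z, EisJSummand 4 1 τ z c d =
      x * theta00 (2 * τ) (2 * z) + y * theta10 (2 * τ) (2 * z) := by
  have hexp : ∀ τ z : ℂ, cexp ((Real.pi : ℂ) * I * z ^ 2 / τ) ^ 2 = e2 ((1 : ℕ) * (z ^ 2 / τ)) := by
    intro τ z
    rw [← Complex.exp_nat_mul, e2]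
    congr 1; push_cast; ring
  obtain ⟨x, y, w, H⟩ := EisJSummand_mem_span 4 1 (X := fun τ z => xi10 τ z ^ 2)
    (Y := fun τ z => xi01 τ z ^ 2) (Z := fun τ z => xi00 τ z ^ 2)
    (fun τ z => by simp only [xi10_add_one_tau]) (fun τ z => by simp only [xi01_add_one_tau])
    (fun τ z => by simp only [xi00_add_one_tau])
    (fun τ z hτ => by simp only [xi10_neg_inv hτ, mul_pow, hexp])
    (fun τ z hτ => by simp only [xi01_neg_inv hτ, mul_pow, hexp])
    (fun τ z hτ => by simp only [xi00_neg_inv hτ, mul_pow, hexp])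
    (fun τ hτ => by
      obtain ⟨h0, h1, h2⟩ := theta_null_ne_zero hτ
      obtain ⟨k0, -⟩ := theta_double_null_ne_zero hτ
      refine ⟨0, theta01 τ 0 ^ 2 / (2 * theta00 (2 * τ) 0),
        theta00 τ 0 ^ 2 / (2 * theta00 (2 * τ) 0), fun z => ?_⟩
      rw [EisJSummand_zero_one 1 hτ, Nat.cast_one, mul_one, ← theta00_eq, xi01, xi00]
      have e0 := theta00_sq hτ z
      have e1 := theta01_sq hτ z
      field_simp
      linear_combination -e0 - e1) c d h τ hτ
  refine ⟨x * theta10 (2 * τ) 0 / theta10 τ 0 ^ 2 + y * theta00 (2 * τ) 0 / theta01 τ 0 ^ 2 +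
    w * theta00 (2 * τ) 0 / theta00 τ 0 ^ 2, x * theta00 (2 * τ) 0 / theta10 τ 0 ^ 2 -
    y * theta10 (2 * τ) 0 / theta01 τ 0 ^ 2 + w * theta10 (2 * τ) 0 / theta00 τ 0 ^ 2,
    fun z => ?_⟩
  rw [H, xi10, xi01, xi00, div_pow, div_pow, div_pow, theta10_sq hτ z, theta01_sq hτ z,
    theta00_sq hτ z]
  ring

lemma e2_mul_theta00_two (τ : ℂ) :
    e2 (τ / 4) * theta00 (2 * τ) τ = theta10 (2 * τ) 0 := by
  rw [theta10_eq, e2]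
  congr 2 <;> ring

lemma e2_mul_theta10_two (τ : ℂ) :
    e2 (τ / 4) * theta10 (2 * τ) τ = theta00 (2 * τ) 0 := by
  have := theta00_add_tau (2 * τ) 0
  rw [theta10_eq, e2, show τ + 2 * τ / 2 = 0 + 2 * τ by ring, this, ← mul_assoc, ← mul_assoc,
    ← Complex.exp_add, ← Complex.exp_add]
  convert! one_mul _
  rw [← Complex.exp_zero]
  congr 1; ring

lemma EisJSummand_one_values {c d : ℤ} {x y : ℂ}
    (H : ∀ z, EisJSummand 4 1 τ z c d =
      x * theta00 (2 * τ) (2 * z) + y * theta10 (2 * τ) (2 * z)) :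
    2 * theta00 (2 * τ) 0 * x = EisJSummand 4 1 τ 0 c d + EisJSummand 4 1 τ (1 / 2) c d ∧
    2 * theta10 (2 * τ) 0 * y = EisJSummand 4 1 τ 0 c d - EisJSummand 4 1 τ (1 / 2) c d := by
  have h1 := theta00_add_one (2 * τ) 0
  have h2 := theta10_add_one (2 * τ) 0
  rw [zero_add] at h1 h2
  refine ⟨?_, ?_⟩
  · rw [H, H, mul_zero, show (2 : ℂ) * (1 / 2) = 1 by norm_num, h1, h2]; ring
  · rw [H, H, mul_zero, show (2 : ℂ) * (1 / 2) = 1 by norm_num, h1, h2]; ring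

lemma EisJ_one_eq_aux (hτ : 0 < τ.im) (z : ℂ) : EisJ 4 1 τ z =
    (Eis 4 τ + EisJ 4 1 τ (1 / 2)) / (2 * theta00 (2 * τ) 0) * theta00 (2 * τ) (2 * z) +
    (Eis 4 τ - EisJ 4 1 τ (1 / 2)) / (2 * theta10 (2 * τ) 0) * theta10 (2 * τ) (2 * z) := by
  obtain ⟨h0, h1⟩ := theta_double_null_ne_zero hτ
  rw [EisJ_linear le_rfl hτ (z := z) (z₀ := 0) (z₁ := 1 / 2)
    (theta00 (2 * τ) (2 * z) / (2 * theta00 (2 * τ) 0) +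
      theta10 (2 * τ) (2 * z) / (2 * theta10 (2 * τ) 0))
    (theta00 (2 * τ) (2 * z) / (2 * theta00 (2 * τ) 0) -
      theta10 (2 * τ) (2 * z) / (2 * theta10 (2 * τ) 0)) ?_, EisJ_zero le_rfl hτ]
  · ring
  · intro c d h
    obtain ⟨x, y, H⟩ := EisJSummand_one_mem_span hτ h
    obtain ⟨hx, hy⟩ := EisJSummand_one_values H
    rw [H]
    field_simp
    linear_combination theta10 (2 * τ) 0 * theta00 (2 * τ) (2 * z) * hx +
      theta00 (2 * τ) 0 * theta10 (2 * τ) (2 * z) * hy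

lemma EisJ_one_half_period (hτ : 0 < τ.im) :
    e2 (τ / 4) * EisJ 4 1 τ (τ / 2) * theta10 τ 0 ^ 2 + EisJ 4 1 τ (1 / 2) * theta01 τ 0 ^ 2 =
      Eis 4 τ * theta00 τ 0 ^ 2 := by
  obtain ⟨h0, h1⟩ := theta_double_null_ne_zero hτ
  have h2 := EisJ_one_eq_aux hτ (τ / 2)
  rw [show 2 * (τ / 2) = τ by ring] at h2
  have h3 : e2 (τ / 4) * EisJ 4 1 τ (τ / 2) =
      (Eis 4 τ + EisJ 4 1 τ (1 / 2)) / (2 * theta00 (2 * τ) 0) * theta10 (2 * τ) 0 +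
      (Eis 4 τ - EisJ 4 1 τ (1 / 2)) / (2 * theta10 (2 * τ) 0) * theta00 (2 * τ) 0 := by
    rw [h2]
    linear_combination
      (Eis 4 τ + EisJ 4 1 τ (1 / 2)) / (2 * theta00 (2 * τ) 0) * e2_mul_theta00_two τ +
      (Eis 4 τ - EisJ 4 1 τ (1 / 2)) / (2 * theta10 (2 * τ) 0) * e2_mul_theta10_two τ
  rw [h3, theta10_sq_null hτ, theta01_sq_null hτ, theta00_sq_null hτ]
  field_simp
  ring

end IndexOne

section HalfPeriod

variable {τ : ℂ}

lemma differentiableAt_EisJ_half {m : ℕ} (hm : 1 ≤ m) (hτ : 0 < τ.im) :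
    DifferentiableAt ℂ (fun τ => EisJ 4 m τ (1 / 2)) τ := by
  have h := differentiableAt_EisJTorsion hm 0 (1 / 2) hτ
  rw [EisJ_torsion_real] at h
  simpa using h

lemma tendsto_EisJ_half {m : ℕ} (hm : 1 ≤ m) :
    Filter.Tendsto (fun τ => EisJ 4 m τ (1 / 2)) stripInfty (nhds 1) := by
  have h := tendsto_EisJTorsion_real hm (mu := 1 / 2) (n := m) (by ring)
  rw [EisJ_torsion_real] at h
  simpa using h

lemma EisJ_half_neg_inv (m : ℕ) (hτ : 0 < τ.im) : EisJ 4 m (-1 / τ) (1 / 2) =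
    τ ^ 4 * (e2 (m * (τ / 4)) * EisJ 4 m τ (τ / 2)) := by
  have h := EisJ_neg_inv 4 m hτ (τ / 2)
  have h0 := ne_zero_of_im_pos hτ
  rw [show τ / 2 / τ = 1 / 2 by field_simp, show (τ / 2) ^ 2 / τ = τ / 4 by field_simp; ring] at h
  rw [h]; ring

lemma EisJ_one_half (hτ : 0 < τ.im) : EisJ 4 1 τ (1 / 2) * (theta00 τ 0 ^ 2 * theta01 τ 0 ^ 2) =
    1 / 2 * (quart00 τ * quart01 τ * (quart00 τ + quart01 τ)) := by
  refine sub_eq_zero.1 (levelOne_eq_zero (k := 6) (by norm_num)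
    (F := fun τ => EisJ 4 1 τ (1 / 2) * (theta00 τ 0 ^ 2 * theta01 τ 0 ^ 2) -
      1 / 2 * (quart00 τ * quart01 τ * (quart00 τ + quart01 τ))) ?_ ?_ ?_ ?_ τ hτ)
  · intro τ hτ
    have hA := differentiableAt_quart00 hτ
    have hB := differentiableAt_quart01 hτ
    exact ((differentiableAt_EisJ_half le_rfl hτ).mul
      (((differentiableAt_theta00_null hτ).pow 2).mul ((differentiableAt_theta01_null hτ).pow 2))).sub
      (((hA.mul hB).mul (hA.add hB)).const_mul _)
  · intro τ hτ
    simp only [EisJ_add_one 4 1 hτ, theta00_add_one_tau, theta01_add_one_tau, quart00_add_one,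
      quart01_add_one]
    ring
  · intro τ hτ
    obtain ⟨h0, h1, -⟩ := theta_null_neg_inv hτ
    have hh := EisJ_one_half_period hτ
    have hk := thetaFactor_pow_four τ
    simp only [EisJ_half_neg_inv 1 hτ, h0, h1, quart00_neg_inv hτ, quart01_neg_inv hτ,
      Nat.cast_one, one_mul]
    have hA : quart00 τ = theta00 τ 0 ^ 4 := rfl
    rw [Eis_four_eq hτ] at hh
    linear_combination τ ^ 4 * (e2 (τ / 4) * EisJ 4 1 τ (τ / 2)) * theta00 τ 0 ^ 2 *
      theta10 τ 0 ^ 2 * hk - τ ^ 6 * theta00 τ 0 ^ 2 * hh - τ ^ 6 *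
      (quart00 τ ^ 2 + quart01 τ ^ 2 - quart00 τ * quart01 τ) * (-hA)
  · have h := ((tendsto_EisJ_half (m := 1) le_rfl).mul ((tendsto_theta00_null.pow 2).mul
      (tendsto_theta01_null.pow 2))).sub (((tendsto_quart00.mul tendsto_quart01).mul
        (tendsto_quart00.add tendsto_quart01)).const_mul (1 / 2))
    convert! h using 2
    norm_num

lemma EisJ_one_half_eq (hτ : 0 < τ.im) :
    EisJ 4 1 τ (1 / 2) = theta00 (2 * τ) 0 ^ 8 - theta10 (2 * τ) 0 ^ 8 := by
  obtain ⟨h0, h1, -⟩ := theta_null_ne_zero hτ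
  refine mul_right_cancel₀ (mul_ne_zero (pow_ne_zero 2 h0) (pow_ne_zero 2 h1)) ?_
  rw [EisJ_one_half hτ, quart00, quart01, show theta00 τ 0 ^ 4 = (theta00 τ 0 ^ 2) ^ 2 by ring,
    show theta01 τ 0 ^ 4 = (theta01 τ 0 ^ 2) ^ 2 by ring, theta00_sq_null hτ, theta01_sq_null hτ]
  ring

lemma quart00_eq (hτ : 0 < τ.im) :
    quart00 τ = (theta00 (2 * τ) 0 ^ 2 + theta10 (2 * τ) 0 ^ 2) ^ 2 := by
  rw [quart00, ← theta00_sq_null hτ]; ring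

lemma quart01_eq (hτ : 0 < τ.im) :
    quart01 τ = (theta00 (2 * τ) 0 ^ 2 - theta10 (2 * τ) 0 ^ 2) ^ 2 := by
  rw [quart01, ← theta01_sq_null hτ]; ring

lemma EisJ_one_eq (hτ : 0 < τ.im) (z : ℂ) : EisJ 4 1 τ z =
    (theta00 (2 * τ) 0 ^ 7 + 7 * theta00 (2 * τ) 0 ^ 3 * theta10 (2 * τ) 0 ^ 4) *
      theta00 (2 * τ) (2 * z) +
    (7 * theta00 (2 * τ) 0 ^ 4 * theta10 (2 * τ) 0 ^ 3 + theta10 (2 * τ) 0 ^ 7) *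
      theta10 (2 * τ) (2 * z) := by
  obtain ⟨h0, h1⟩ := theta_double_null_ne_zero hτ
  rw [EisJ_one_eq_aux hτ, EisJ_one_half_eq hτ, Eis_four_eq hτ, quart00_eq hτ, quart01_eq hτ]
  field_simp
  ring

end HalfPeriod

section IndexTwo

variable {τ : ℂ}

lemma EisJSummand_two_mem_span (hτ : 0 < τ.im) {c d : ℤ} (h : IsCoprime c d) :
    ∃ x y w : ℂ, ∀ z, EisJSummand 4 2 τ z c d =
      x * xi10 τ (2 * z) + y * xi01 τ (2 * z) + w * xi00 τ (2 * z) := by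
  have hexp : ∀ τ z : ℂ,
      cexp ((Real.pi : ℂ) * I * (2 * z) ^ 2 / τ) = e2 ((2 : ℕ) * (z ^ 2 / τ)) := by
    intro τ z
    rw [e2]
    congr 1; push_cast; ring
  refine EisJSummand_mem_span 4 2 (X := fun τ z => xi10 τ (2 * z))
    (Y := fun τ z => xi01 τ (2 * z)) (Z := fun τ z => xi00 τ (2 * z))
    (fun τ z => by simp only [xi10_add_one_tau]) (fun τ z => by simp only [xi01_add_one_tau])
    (fun τ z => by simp only [xi00_add_one_tau])
    (fun τ z hτ => by simp only [← mul_div_assoc, xi10_neg_inv hτ, hexp])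
    (fun τ z hτ => by simp only [← mul_div_assoc, xi01_neg_inv hτ, hexp])
    (fun τ z hτ => by simp only [← mul_div_assoc, xi00_neg_inv hτ, hexp])
    (fun τ hτ => ?_) c d h τ hτ
  obtain ⟨h0, h1, -⟩ := theta_null_ne_zero hτ
  refine ⟨0, theta01 τ 0 / 2, theta00 τ 0 / 2, fun z => ?_⟩
  have h2 : theta00 (4 * τ) (2 * (2 * z)) = (theta00 τ (2 * z) + theta01 τ (2 * z)) / 2 := by
    rw [theta00_add_theta01 hτ]; ring
  rw [EisJSummand_zero_one 2 hτ, xi01, xi00,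
    show (2 * (2 : ℕ) * z : ℂ) = 2 * (2 * z) by push_cast; ring,
    show (2 * (2 : ℕ) * τ : ℂ) = 4 * τ by push_cast; ring, ← theta00_eq, h2]
  field_simp
  ring

lemma xi_zero (hτ : 0 < τ.im) : xi10 τ 0 = 1 ∧ xi01 τ 0 = 1 ∧ xi00 τ 0 = 1 := by
  obtain ⟨h0, h1, h2⟩ := theta_null_ne_zero hτ
  exact ⟨div_self h2, div_self h1, div_self h0⟩

lemma xi_add_one (τ z : ℂ) :
    xi10 τ (z + 1) = -xi10 τ z ∧ xi01 τ (z + 1) = xi01 τ z ∧ xi00 τ (z + 1) = xi00 τ z := by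
  refine ⟨?_, ?_, ?_⟩
  · rw [xi10, theta10_add_one, neg_div, xi10]
  · rw [xi01, theta01_eq, show z + 1 + 1 / 2 = z + 1 / 2 + 1 by ring, theta00_add_one,
      ← theta01_eq, xi01]
  · rw [xi00, theta00_add_one, xi00]

lemma xi_add_tau (τ z : ℂ) :
    xi10 τ (z + τ) = cexp (-Real.pi * I * (τ + 2 * z)) * xi10 τ z ∧
    xi01 τ (z + τ) = -(cexp (-Real.pi * I * (τ + 2 * z)) * xi01 τ z) ∧
    xi00 τ (z + τ) = cexp (-Real.pi * I * (τ + 2 * z)) * xi00 τ z := by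
  refine ⟨?_, ?_, ?_⟩
  · rw [xi10, xi10, theta10_eq τ (z + τ), theta10_eq τ z,
      show z + τ + τ / 2 = z + τ / 2 + τ by ring, theta00_add_tau, ← mul_assoc, ← mul_div_assoc,
      ← mul_assoc, ← Complex.exp_add, ← Complex.exp_add]
    congr 3; ring
  · rw [xi01, xi01, theta01_eq τ (z + τ), theta01_eq τ z,
      show z + τ + 1 / 2 = z + 1 / 2 + τ by ring, theta00_add_tau,
      show -Real.pi * I * (τ + 2 * (z + 1 / 2)) = -Real.pi * I * (τ + 2 * z) - Real.pi * I by ring,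
      Complex.exp_sub, Complex.exp_pi_mul_I]
    ring
  · rw [xi00, xi00, theta00_add_tau, mul_div_assoc]

end IndexTwo

section IndexTwo

variable {τ : ℂ}

/-- The value of `E_{4,2}` at the half-period `τ/2`, normalized by its theta multiplier. -/
def EisJTwoHalfTau (τ : ℂ) : ℂ := e2 (τ / 2) * EisJ 4 2 τ (τ / 2)

lemma xi_tau (hτ : 0 < τ.im) : e2 (τ / 2) * xi10 τ τ = 1 ∧ e2 (τ / 2) * xi01 τ τ = -1 ∧
    e2 (τ / 2) * xi00 τ τ = 1 := by
  obtain ⟨h0, h1, h2⟩ := xi_zero hτ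
  obtain ⟨k0, k1, k2⟩ := xi_add_tau τ 0
  rw [zero_add] at k0 k1 k2
  have he : e2 (τ / 2) * cexp (-Real.pi * I * (τ + 2 * 0)) = 1 := by
    rw [e2, ← Complex.exp_add, ← Complex.exp_zero]
    congr 1; ring
  refine ⟨?_, ?_, ?_⟩
  · rw [k0, h0, mul_one, he]
  · rw [k1, h1, mul_one, mul_neg, he]
  · rw [k2, h2, mul_one, he]

lemma xi_one (hτ : 0 < τ.im) : xi10 τ 1 = -1 ∧ xi01 τ 1 = 1 ∧ xi00 τ 1 = 1 := by
  obtain ⟨h0, h1, h2⟩ := xi_zero hτ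
  obtain ⟨k0, k1, k2⟩ := xi_add_one τ 0
  rw [zero_add] at k0 k1 k2
  exact ⟨by rw [k0, h0], by rw [k1, h1], by rw [k2, h2]⟩

lemma EisJ_two_eq_aux (hτ : 0 < τ.im) (z : ℂ) : EisJ 4 2 τ z =
    (Eis 4 τ - EisJ 4 2 τ (1 / 2)) / 2 * xi10 τ (2 * z) +
    (Eis 4 τ - EisJTwoHalfTau τ) / 2 * xi01 τ (2 * z) +
    (EisJ 4 2 τ (1 / 2) + EisJTwoHalfTau τ) / 2 * xi00 τ (2 * z) := by
  obtain ⟨h0, h1, h2⟩ := xi_zero hτ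
  obtain ⟨k0, k1, k2⟩ := xi_one hτ
  obtain ⟨l0, l1, l2⟩ := xi_tau hτ
  rw [EisJ_linear₃ one_le_two hτ (z := z) (z₀ := 0) (z₁ := 1 / 2) (z₂ := τ / 2)
    ((xi10 τ (2 * z) + xi01 τ (2 * z)) / 2) ((xi00 τ (2 * z) - xi10 τ (2 * z)) / 2)
    ((xi00 τ (2 * z) - xi01 τ (2 * z)) / 2 * e2 (τ / 2)) ?_, EisJ_zero one_le_two hτ,
    EisJTwoHalfTau]
  · ring
  · intro c d h
    obtain ⟨x, y, w, H⟩ := EisJSummand_two_mem_span hτ h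
    rw [H, H, H, H, mul_zero, show (2 : ℂ) * (1 / 2) = 1 by norm_num,
      show 2 * (τ / 2) = τ by ring, h0, h1, h2, k0, k1, k2]
    linear_combination -(xi00 τ (2 * z) - xi01 τ (2 * z)) / 2 * (x * l0 + y * l1 + w * l2)

lemma EisJTwoHalfTau_add_one (hτ : 0 < τ.im) :
    EisJTwoHalfTau (τ + 1) = Eis 4 τ - EisJ 4 2 τ (1 / 2) - EisJTwoHalfTau τ := by
  obtain ⟨l0, l1, l2⟩ := xi_tau hτ
  obtain ⟨k0, k1, k2⟩ := xi_add_one τ τ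
  have he : e2 ((τ + 1) / 2) = -e2 (τ / 2) := by
    rw [e2, e2, show 2 * Real.pi * I * ((τ + 1) / 2) = 2 * Real.pi * I * (τ / 2) + Real.pi * I by
      ring, Complex.exp_add, Complex.exp_pi_mul_I]
    ring
  rw [EisJTwoHalfTau, EisJ_add_one 4 2 hτ, he, EisJ_two_eq_aux hτ,
    show 2 * ((τ + 1) / 2) = τ + 1 by ring, k0, k1, k2]
  linear_combination (Eis 4 τ - EisJ 4 2 τ (1 / 2)) / 2 * l0 -
    (Eis 4 τ - EisJTwoHalfTau τ) / 2 * l1 - (EisJ 4 2 τ (1 / 2) + EisJTwoHalfTau τ) / 2 * l2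

lemma EisJ_two_half_neg_inv (hτ : 0 < τ.im) :
    EisJ 4 2 (-1 / τ) (1 / 2) = τ ^ 4 * EisJTwoHalfTau τ := by
  rw [EisJ_half_neg_inv 2 hτ, EisJTwoHalfTau]
  congr 3
  push_cast; ring

lemma EisJTwoHalfTau_neg_inv (hτ : 0 < τ.im) :
    EisJTwoHalfTau (-1 / τ) = τ ^ 4 * EisJ 4 2 τ (1 / 2) := by
  have h := EisJ_two_half_neg_inv (neg_one_div_im_pos hτ)
  have h0 := ne_zero_of_im_pos hτ
  rw [show -1 / (-1 / τ) = τ by field_simp] at h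
  rw [h]
  field_simp

lemma EisJTwoHalfTau_eq : EisJTwoHalfTau = EisJTorsion 2 (1 / 2) 0 := by
  ext τ
  rw [EisJTwoHalfTau, EisJTorsion]
  congr 2 <;> push_cast <;> ring

lemma tendsto_theta10_null_comap : Filter.Tendsto (fun τ => theta10 τ 0)
    (Filter.comap Complex.im Filter.atTop) (nhds 0) := by
  have h0 := tendsto_theta00_null_comap.pow 4
  have h1 : Filter.Tendsto (fun τ : ℂ => theta00 (τ + 1) 0 ^ 4)
      (Filter.comap Complex.im Filter.atTop) (nhds (1 ^ 4)) := by
    refine (tendsto_theta00_null_comap.comp (Filter.tendsto_comap_iff.2 ?_)).pow 4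
    simpa [Function.comp_def] using Filter.tendsto_comap
  have h2 := h0.sub h1
  rw [sub_self] at h2
  have h3 : Filter.Tendsto (fun τ => theta10 τ 0 ^ 4)
      (Filter.comap Complex.im Filter.atTop) (nhds 0) := by
    refine h2.congr' ?_
    filter_upwards [Filter.preimage_mem_comap (Filter.Ioi_mem_atTop (0 : ℝ))] with τ hτ
    rw [theta10_pow_four hτ, theta00_add_one_tau, quart00, quart01]
  rw [Metric.tendsto_nhds] at h3 ⊢
  intro ε hε
  filter_upwards [h3 (ε ^ 4) (by positivity)] with τ hτ
  rw [dist_zero_right, norm_pow] at hτ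
  rw [dist_zero_right]
  exact lt_of_pow_lt_pow_left₀ 4 hε.le hτ

lemma tendsto_EisJTwoHalfTau : Filter.Tendsto EisJTwoHalfTau stripInfty (nhds 0) := by
  rw [EisJTwoHalfTau_eq]
  refine tendsto_EisJTorsion one_le_two _ _ ?_
  refine (tendsto_theta10_null_comap.comp (tendsto_const_mul_im (r := 4) (by norm_num))).congr
    fun τ => ?_
  simp only [Function.comp_apply]
  rw [theta10_eq, theta00_eq, e2]
  congr 2 <;> push_cast <;> ring

end IndexTwo

section IndexTwoValues

variable {τ : ℂ}

lemma differentiableAt_EisJTwoHalfTau (hτ : 0 < τ.im) : DifferentiableAt ℂ EisJTwoHalfTau τ := by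
  rw [EisJTwoHalfTau_eq]
  exact differentiableAt_EisJTorsion one_le_two _ _ hτ

lemma EisJ_two_first_moment (hτ : 0 < τ.im) :
    (EisJ 4 2 τ (1 / 2) - quart00 τ * quart01 τ) * (quart00 τ + quart01 τ) +
    (EisJTwoHalfTau τ - quart00 τ ^ 2 + quart00 τ * quart01 τ) * (quart01 τ - 2 * quart00 τ) +
    (quart00 τ ^ 2 - EisJ 4 2 τ (1 / 2) - EisJTwoHalfTau τ) * (quart00 τ - 2 * quart01 τ) = 0 := by
  refine levelOne_eq_zero (k := 6) (by norm_num) (F := fun τ =>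
    (EisJ 4 2 τ (1 / 2) - quart00 τ * quart01 τ) * (quart00 τ + quart01 τ) +
    (EisJTwoHalfTau τ - quart00 τ ^ 2 + quart00 τ * quart01 τ) * (quart01 τ - 2 * quart00 τ) +
    (quart00 τ ^ 2 - EisJ 4 2 τ (1 / 2) - EisJTwoHalfTau τ) * (quart00 τ - 2 * quart01 τ))
    ?_ ?_ ?_ ?_ τ hτ
  · intro τ hτ
    have := differentiableAt_quart00 hτ
    have := differentiableAt_quart01 hτ
    have := differentiableAt_EisJ_half one_le_two hτ
    have := differentiableAt_EisJTwoHalfTau hτ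
    fun_prop
  · intro τ hτ
    simp only [EisJ_add_one 4 2 hτ, EisJTwoHalfTau_add_one hτ, quart00_add_one, quart01_add_one,
      Eis_four_eq hτ]
    ring
  · intro τ hτ
    simp only [EisJ_two_half_neg_inv hτ, EisJTwoHalfTau_neg_inv hτ, quart00_neg_inv hτ,
      quart01_neg_inv hτ]
    ring
  · have hA := tendsto_quart00
    have hB := tendsto_quart01
    have hf := tendsto_EisJ_half one_le_two
    have hg := tendsto_EisJTwoHalfTau
    convert! (((hf.sub (hA.mul hB)).mul (hA.add hB)).add
      (((hg.sub (hA.pow 2)).add (hA.mul hB)).mul (hB.sub (hA.const_mul 2)))).add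
      ((((hA.pow 2).sub hf).sub hg).mul (hA.sub (hB.const_mul 2))) using 2
    norm_num

lemma EisJ_two_second_moment (hτ : 0 < τ.im) :
    (EisJ 4 2 τ (1 / 2) - quart00 τ * quart01 τ) * (quart00 τ + quart01 τ) ^ 2 +
    (EisJTwoHalfTau τ - quart00 τ ^ 2 + quart00 τ * quart01 τ) *
      (quart01 τ - 2 * quart00 τ) ^ 2 +
    (quart00 τ ^ 2 - EisJ 4 2 τ (1 / 2) - EisJTwoHalfTau τ) *
      (quart00 τ - 2 * quart01 τ) ^ 2 = 0 := by
  refine levelOne_eq_zero (k := 8) (by norm_num) (F := fun τ =>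
    (EisJ 4 2 τ (1 / 2) - quart00 τ * quart01 τ) * (quart00 τ + quart01 τ) ^ 2 +
    (EisJTwoHalfTau τ - quart00 τ ^ 2 + quart00 τ * quart01 τ) *
      (quart01 τ - 2 * quart00 τ) ^ 2 +
    (quart00 τ ^ 2 - EisJ 4 2 τ (1 / 2) - EisJTwoHalfTau τ) *
      (quart00 τ - 2 * quart01 τ) ^ 2) ?_ ?_ ?_ ?_ τ hτ
  · intro τ hτ
    have := differentiableAt_quart00 hτ
    have := differentiableAt_quart01 hτ
    have := differentiableAt_EisJ_half one_le_two hτ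
    have := differentiableAt_EisJTwoHalfTau hτ
    fun_prop
  · intro τ hτ
    simp only [EisJ_add_one 4 2 hτ, EisJTwoHalfTau_add_one hτ, quart00_add_one, quart01_add_one,
      Eis_four_eq hτ]
    ring
  · intro τ hτ
    simp only [EisJ_two_half_neg_inv hτ, EisJTwoHalfTau_neg_inv hτ, quart00_neg_inv hτ,
      quart01_neg_inv hτ]
    ring
  · have hA := tendsto_quart00
    have hB := tendsto_quart01
    have hf := tendsto_EisJ_half one_le_two
    have hg := tendsto_EisJTwoHalfTau
    convert! (((hf.sub (hA.mul hB)).mul ((hA.add hB).pow 2)).add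
      (((hg.sub (hA.pow 2)).add (hA.mul hB)).mul ((hB.sub (hA.const_mul 2)).pow 2))).add
      ((((hA.pow 2).sub hf).sub hg).mul ((hA.sub (hB.const_mul 2)).pow 2)) using 2
    norm_num

lemma EisJ_two_values (hτ : 0 < τ.im) : EisJ 4 2 τ (1 / 2) = quart00 τ * quart01 τ ∧
    EisJTwoHalfTau τ = quart00 τ ^ 2 - quart00 τ * quart01 τ := by
  obtain ⟨h0, h1, h2⟩ := theta_null_ne_zero hτ
  have hA : quart00 τ ≠ 0 := pow_ne_zero 4 h0
  have hB : quart01 τ ≠ 0 := pow_ne_zero 4 h1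
  have hC : quart00 τ - quart01 τ ≠ 0 := by
    rw [← theta10_pow_four hτ]; exact pow_ne_zero 4 h2
  have m1 := EisJ_two_first_moment hτ
  have m2 := EisJ_two_second_moment hτ
  have hg : EisJTwoHalfTau τ - (quart00 τ ^ 2 - quart00 τ * quart01 τ) = 0 := by
    have : (quart00 τ * (quart00 τ - quart01 τ)) *
        (EisJTwoHalfTau τ - (quart00 τ ^ 2 - quart00 τ * quart01 τ)) = 0 := by
      linear_combination (m2 - (2 * quart00 τ - quart01 τ) * m1) / 9
    exact (mul_eq_zero.1 this).resolve_left (mul_ne_zero hA hC)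
  refine ⟨mul_left_cancel₀ hB ?_, sub_eq_zero.1 hg⟩
  linear_combination m1 / 3 + (quart00 τ - quart01 τ) * hg

lemma EisJ_two_eq (hτ : 0 < τ.im) (z : ℂ) : EisJ 4 2 τ z =
    1 / 2 * (theta10 τ 0 ^ 8 * xi10 τ (2 * z) + theta01 τ 0 ^ 8 * xi01 τ (2 * z) +
      theta00 τ 0 ^ 8 * xi00 τ (2 * z)) := by
  obtain ⟨hf, hg⟩ := EisJ_two_values hτ
  have hC := theta10_pow_four hτ
  rw [EisJ_two_eq_aux hτ, hf, hg, Eis_four_eq hτ, show theta10 τ 0 ^ 8 = (theta10 τ 0 ^ 4) ^ 2 by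
    ring, hC, quart00, quart01]
  ring

end IndexTwoValues

section DoubledPeriod

variable {τ : ℂ}

lemma phi01_eq (hτ : 0 < τ.im) (z : ℂ) : phi01 τ z =
    4 * ((theta00 (2 * τ) 0 * theta00 (2 * τ) (2 * z) +
        theta10 (2 * τ) 0 * theta10 (2 * τ) (2 * z)) /
        (theta00 (2 * τ) 0 ^ 2 + theta10 (2 * τ) 0 ^ 2) +
      (theta00 (2 * τ) 0 * theta00 (2 * τ) (2 * z) -
        theta10 (2 * τ) 0 * theta10 (2 * τ) (2 * z)) /
        (theta00 (2 * τ) 0 ^ 2 - theta10 (2 * τ) 0 ^ 2) +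
      (theta10 (2 * τ) 0 * theta00 (2 * τ) (2 * z) +
        theta00 (2 * τ) 0 * theta10 (2 * τ) (2 * z)) /
        (2 * theta00 (2 * τ) 0 * theta10 (2 * τ) 0)) := by
  rw [phi01, xi00, xi01, xi10, div_pow, div_pow, div_pow, theta00_sq hτ z, theta01_sq hτ z,
    theta10_sq hτ z, theta00_sq_null hτ, theta01_sq_null hτ, theta10_sq_null hτ]

lemma phiM21_eq (hτ : 0 < τ.im) (z : ℂ) : phiM21 τ z =
    4 * (theta00 (2 * τ) 0 * theta10 (2 * τ) (2 * z) -
        theta10 (2 * τ) 0 * theta00 (2 * τ) (2 * z)) /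
      ((theta00 (2 * τ) 0 ^ 2 + theta10 (2 * τ) 0 ^ 2) *
        (theta00 (2 * τ) 0 ^ 2 - theta10 (2 * τ) 0 ^ 2) *
        (2 * theta00 (2 * τ) 0 * theta10 (2 * τ) 0)) := by
  have h : 4 * eta τ ^ 6 = theta00 τ 0 ^ 2 * theta01 τ 0 ^ 2 * theta10 τ 0 ^ 2 := by
    linear_combination -(theta00 τ 0 * theta01 τ 0 * theta10 τ 0 + 2 * eta τ ^ 3) *
      theta_null_product hτ
  rw [phiM21, theta_sq hτ, theta10_half_sq hτ, ← theta00_sq_null hτ, ← theta01_sq_null hτ,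
    ← theta10_sq_null hτ, ← h, mul_div_mul_left _ _ (by norm_num)]
  ring

lemma xi_double (hτ : 0 < τ.im) (z : ℂ) :
    xi00 τ (2 * z) = (theta00 (2 * τ) (2 * z) ^ 2 + theta10 (2 * τ) (2 * z) ^ 2) /
      (theta00 (2 * τ) 0 ^ 2 + theta10 (2 * τ) 0 ^ 2) ∧
    xi01 τ (2 * z) = (theta00 (2 * τ) (2 * z) ^ 2 - theta10 (2 * τ) (2 * z) ^ 2) /
      (theta00 (2 * τ) 0 ^ 2 - theta10 (2 * τ) 0 ^ 2) ∧
    xi10 τ (2 * z) = 2 * theta00 (2 * τ) (2 * z) * theta10 (2 * τ) (2 * z) /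
      (2 * theta00 (2 * τ) 0 * theta10 (2 * τ) 0) := by
  obtain ⟨h0, h1, h2⟩ := theta_null_ne_zero hτ
  refine ⟨?_, ?_, ?_⟩
  · rw [← theta00_double hτ, ← theta00_sq_null hτ, sq, mul_div_mul_right _ _ h0, xi00]
  · rw [← theta01_double hτ, ← theta01_sq_null hτ, sq, mul_div_mul_right _ _ h1, xi01]
  · rw [← theta10_double hτ, ← theta10_sq_null hτ, sq, mul_div_mul_right _ _ h2, xi10]

end DoubledPeriod

/-- `6 E_{4,2} = E_{4,1} φ_{0,1} - E₄ φ_{0,2}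
= (1/24)(E₄ φ_{0,1}² - 2 E₆ φ_{0,1} φ_{-2,1} + E₄² φ_{-2,1}²)` on `ℍ × ℂ`. -/
theorem six_E42 (τ z : ℂ) (hτ : 0 < τ.im) :
    6 * EisJ 4 2 τ z = EisJ 4 1 τ z * phi01 τ z - Eis 4 τ * phi02 τ z ∧
    6 * EisJ 4 2 τ z = (1 / 24) * (Eis 4 τ * phi01 τ z ^ 2 -
      2 * Eis 6 τ * phi01 τ z * phiM21 τ z + Eis 4 τ ^ 2 * phiM21 τ z ^ 2) := by
  obtain ⟨h0, h1, h2⟩ := theta_null_ne_zero hτ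
  obtain ⟨hα, hβ⟩ := theta_double_null_ne_zero hτ
  have ha := pow_ne_zero 2 h0
  have hb := pow_ne_zero 2 h1
  rw [theta00_sq_null hτ] at ha
  rw [theta01_sq_null hτ] at hb
  obtain ⟨x0, x1, x2⟩ := xi_double hτ z
  rw [EisJ_two_eq hτ, EisJ_one_eq hτ, phi02, x0, x1, x2, phi01_eq hτ, phiM21_eq hτ,
    Eis_four_eq hτ, Eis_six_eq hτ, quart00_eq hτ, quart01_eq hτ,
    show theta10 τ 0 ^ 8 = (theta10 τ 0 ^ 2) ^ 4 by ring,
    show theta01 τ 0 ^ 8 = (theta01 τ 0 ^ 2) ^ 4 by ring,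
    show theta00 τ 0 ^ 8 = (theta00 τ 0 ^ 2) ^ 4 by ring,
    theta00_sq_null hτ, theta01_sq_null hτ, theta10_sq_null hτ]
  generalize theta00 (2 * τ) 0 = α at *
  generalize theta10 (2 * τ) 0 = β at *
  generalize theta00 (2 * τ) (2 * z) = p
  generalize theta10 (2 * τ) (2 * z) = r
  constructor
  · field_simp
    ring
  · field_simp
    ring

end JacobiPaper
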